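/- arXiv:1708.06460 — 5 statements merged into one kernel-verified Lean document; each statement's English description precedes it below -/
import Mathlib

section
/- Let k ≥ 1 and let ⋃_{i ∈ I} L(x_i, P_i) be a semilinear subset of ℕ^k with I nonempty finite. Set n = max_{i ∈ I} ‖P_i‖, m = max_{i ∈ I} |P_i|, and ℓ = max_{i ∈ I} ‖x_i‖, and define b(k,n,m,I) = (√k·(n+2))^{k·log₂(3k+2)·(3m+1)+3} · (3k+2)^{−(2 log₂(e)+1)m+7} · |I|^{log₂(3k+2)}. Then there exists an index set J with |J| ≤ 2^{b(k,n,m,I)} · (ℓ+2)^{(√k·(n+2))^{k(3m+1)+8} · (2e²)^{−m} · |I|} such that for each j ∈ J there are finite sets P_j, C_j ⊆ ℕ^k with ‖P_j‖ ≤ 2^{b(k,n,m,I)} and ‖C_j‖ ≤ 2^{b(k,n,m,I)}·(ℓ+1), and ℕ^k \ ⋃_{i ∈ I} L(x_i, P_i) = ⋃_{j ∈ J} L(C_j, P_j). -/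
/-- Maximum norm of a vector in `ℕ^k`. -/
def vnorm {k : ℕ} (x : Fin k → ℕ) : ℕ := Finset.univ.sup x

/-- Maximum norm of a finite set of vectors in `ℕ^k` (`0` for the empty set). -/
def snorm {k : ℕ} (P : Finset (Fin k → ℕ)) : ℕ := P.sup vnorm

/-- The set `L(C,P) = { c + ∑_{x ∈ P} λ_x • x : c ∈ C, λ_x ∈ ℕ }`. -/
def LSet {k : ℕ} (C P : Finset (Fin k → ℕ)) : Set (Fin k → ℕ) :=
  {v | ∃ c ∈ C, ∃ lam : (Fin k → ℕ) → ℕ, v = c + ∑ x ∈ P, lam x • x}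

/-- The linear set `L(c,P)` with a single constant vector `c`. -/
def LSet1 {k : ℕ} (c : Fin k → ℕ) (P : Finset (Fin k → ℕ)) : Set (Fin k → ℕ) :=
  LSet {c} P

/-- A finite set of vectors of `ℕ^k` is linearly independent if its elements,
viewed as vectors in `ℚ^k`, are linearly independent. -/
def LinIndep {k : ℕ} (P : Finset (Fin k → ℕ)) : Prop :=
  LinearIndependent ℚ (fun x : P => fun i => ((x : Fin k → ℕ) i : ℚ))

open Matrix in
/-- cast -/
def qv {k : ℕ} (z : Fin k → ℤ) : Fin k → ℚ := fun i => (z i : ℚ)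

open Matrix in
lemma cs_exists_matrix {k : ℕ} (s t : Set (Fin k → ℤ)) (hst : s ⊆ t)
    (hs : LinearIndepOn ℚ qv s)
    (ht : ∀ w : Fin k → ℚ, (∀ z ∈ t, qv z ⬝ᵥ w = 0) → w = 0) :
    ∃ A : Matrix (Fin k) (Fin k) ℤ, (∀ i, A i ∈ t) ∧ (∀ z ∈ s, ∃ i, A i = z) ∧ A.det ≠ 0 := by
  obtain ⟨b, hbt, hsb, hspan, hli⟩ := exists_linearIndepOn_extension hs hst
  have htop : ⊤ ≤ Submodule.span ℚ (Set.range (fun z : b => qv (z : Fin k → ℤ))) := by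
    by_contra hcon
    have hlt : Submodule.span ℚ (Set.range (fun z : b => qv (z : Fin k → ℤ))) < ⊤ :=
      lt_of_le_of_ne le_top (fun h => hcon h.ge)
    obtain ⟨f, hf0, hf⟩ := Submodule.exists_le_ker_of_lt_top _ hlt
    apply hf0
    have hrange : Set.range (fun z : b => qv (z : Fin k → ℤ)) = qv '' b := by
      ext y; simp
    rw [hrange] at hf
    have hfe : ∀ y, f y = y ⬝ᵥ (fun i => f (fun j => if i = j then 1 else 0)) := by
      intro y
      rw [LinearMap.pi_apply_eq_sum_univ f y]
      simp [dotProduct]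
    have hw := ht (fun i => f (fun j => if i = j then 1 else 0)) (by
      intro z hz
      rw [← hfe]
      have := hf (hspan ⟨z, hz, rfl⟩)
      simpa using this)
    apply LinearMap.ext
    intro y
    rw [hfe, hw]
    simp
  let bas := Module.Basis.mk (v := fun z : b => qv (z : Fin k → ℤ)) hli htop
  have : Fintype b := FiniteDimensional.fintypeBasisIndex bas
  have hcard : Fintype.card b = k := by
    rw [← Module.finrank_eq_card_basis bas]; simp
  let e : Fin k ≃ b := (Fintype.equivFinOfCardEq hcard).symm
  refine ⟨fun i => (e i : Fin k → ℤ), fun i => hbt (e i).2, ?_, ?_⟩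
  · intro z hz
    exact ⟨e.symm ⟨z, hsb hz⟩, by simp⟩
  · intro hdet
    have hli2 : LinearIndependent ℚ (fun i => qv ((e i : b) : Fin k → ℤ)) :=
      LinearIndependent.comp (v := fun z : b => qv (z : Fin k → ℤ)) hli e e.injective
    have hu := Matrix.linearIndependent_rows_iff_isUnit (A := fun i => qv ((e i : b) : Fin k → ℤ)) |>.1 hli2
    replace hu := (Matrix.isUnit_iff_isUnit_det _).1 hu
    have : (Matrix.det (fun i => qv ((e i : b) : Fin k → ℤ))) =
       (Int.castRingHom ℚ) (Matrix.det (fun i => ((e i : b) : Fin k → ℤ))) := by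
      exact ((Int.castRingHom ℚ).map_det _).symm
    rw [this, hdet] at hu
    simp at hu

lemma cs_det_bound {k : ℕ} (A : Matrix (Fin k) (Fin k) ℤ) (M : ℕ) (hA : ∀ i j, |A i j| ≤ M) :
    |A.det| ≤ (k.factorial * M ^ k : ℕ) := by
  have := Matrix.det_le (A := A) (abv := AbsoluteValue.abs) (x := (M : ℤ)) hA
  simpa using this

lemma cs_adj_bound {k : ℕ} (A : Matrix (Fin k) (Fin k) ℤ) (M : ℕ) (hM : 1 ≤ M)
    (hA : ∀ i j, |A i j| ≤ M) (i j : Fin k) :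
    |A.adjugate i j| ≤ (k.factorial * M ^ k : ℕ) := by
  rw [Matrix.adjugate_apply]
  apply cs_det_bound
  intro a c
  by_cases h : a = j
  · subst h
    simp only [Matrix.updateRow_self]
    by_cases h2 : c = i
    · subst h2; simp; exact_mod_cast hM
    · simp [h2]
  · simp [Matrix.updateRow_ne h, hA]

open Matrix in
/-- move along a direction until a new constraint becomes tight -/
lemma cs_move {k : ℕ} {κ : Type*} [Finite κ] (g : κ → Fin k → ℤ) (β : κ → ℚ)
    (w d : Fin k → ℚ) (hw : ∀ a, β a ≤ qv (g a) ⬝ᵥ w)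
    (hd : ∀ a, qv (g a) ⬝ᵥ w = β a → 0 ≤ qv (g a) ⬝ᵥ d)
    (hneg : ∃ a, qv (g a) ⬝ᵥ d < 0) :
    ∃ t : ℚ, 0 < t ∧ (∀ a, β a ≤ qv (g a) ⬝ᵥ (w + t • d)) ∧
      ∃ a, qv (g a) ⬝ᵥ d < 0 ∧ qv (g a) ⬝ᵥ (w + t • d) = β a := by
  obtain ⟨a, ha, hmin⟩ := Set.exists_min_image {a | qv (g a) ⬝ᵥ d < 0}
    (fun a => (qv (g a) ⬝ᵥ w - β a) / (-(qv (g a) ⬝ᵥ d))) (Set.toFinite _) hneg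
  simp only [Set.mem_ofPred_eq] at ha hmin
  have hpos : ∀ a, qv (g a) ⬝ᵥ d < 0 → 0 < (qv (g a) ⬝ᵥ w - β a) / (-(qv (g a) ⬝ᵥ d)) := by
    intro a ha
    apply div_pos _ (by linarith)
    rcases lt_or_eq_of_le (hw a) with h | h
    · linarith
    · have := hd a h.symm; linarith
  refine ⟨_, hpos a ha, ?_, a, ha, ?_⟩
  · intro c
    rw [dotProduct_add, dotProduct_smul, smul_eq_mul]
    by_cases hc : qv (g c) ⬝ᵥ d < 0
    · have h1 := hmin c hc
      rw [le_div_iff₀ (by linarith)] at h1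
      linarith
    · push Not at hc
      have := mul_nonneg (hpos a ha).le hc
      have := hw c
      linarith
  · rw [dotProduct_add, dotProduct_smul, smul_eq_mul]
    have : qv (g a) ⬝ᵥ d ≠ 0 := ha.ne
    field_simp
    ring

open Matrix in
lemma cs_cramer {k : ℕ} (A : Matrix (Fin k) (Fin k) ℤ) (w y : Fin k → ℚ)
    (h : ∀ i, qv (A i) ⬝ᵥ w = y i) (i : Fin k) :
    (A.det : ℚ) * w i = ∑ j, (A.adjugate i j : ℚ) * y j := by
  have h1 : (A.map (Int.castRingHom ℚ)) *ᵥ w = y := by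
    ext j; rw [← h j]; rfl
  have h2 : (A.map (Int.castRingHom ℚ)).adjugate *ᵥ ((A.map (Int.castRingHom ℚ)) *ᵥ w) =
      (A.map (Int.castRingHom ℚ)).det • w := by
    rw [mulVec_mulVec, adjugate_mul, smul_mulVec, one_mulVec]
  rw [h1] at h2
  have h3 := congrFun h2 i
  have h4 : (A.map (Int.castRingHom ℚ)).det = (A.det : ℚ) := by
    exact ((Int.castRingHom ℚ).map_det A).symm
  have h5 : (A.map (Int.castRingHom ℚ)).adjugate = A.adjugate.map (Int.castRingHom ℚ) :=
    ((Int.castRingHom ℚ).map_adjugate A).symm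
  rw [h4, h5] at h3
  simp only [Pi.smul_apply, smul_eq_mul] at h3
  rw [← h3]
  simp [mulVec, dotProduct]

/-- bound for rays -/
def cB (k M : ℕ) : ℕ := k * (k.factorial * M ^ k)

open Matrix in
lemma cs_ray {k : ℕ} {κ : Type*} [Finite κ] (g : κ → Fin k → ℤ) (M : ℕ) (hM : 1 ≤ M)
    (hg : ∀ a i, |g a i| ≤ M)
    (hpt : ∀ w : Fin k → ℚ, (∀ a, qv (g a) ⬝ᵥ w = 0) → w = 0)
    (Z : Set κ) (w₀ : Fin k → ℚ) (hw₀ : w₀ ≠ 0) (hC : ∀ a, 0 ≤ qv (g a) ⬝ᵥ w₀)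
    (hZ : ∀ a ∈ Z, qv (g a) ⬝ᵥ w₀ = 0) :
    ∃ r : Fin k → ℤ, r ≠ 0 ∧ (∀ a, 0 ≤ qv (g a) ⬝ᵥ qv r) ∧ (∀ a ∈ Z, qv (g a) ⬝ᵥ qv r = 0) ∧
      ∀ i, |r i| ≤ cB k M := by
  classical
  -- minimal support vector
  let S : Set (Fin k → ℚ) := {w | w ≠ 0 ∧ (∀ a, 0 ≤ qv (g a) ⬝ᵥ w) ∧ ∀ a ∈ Z, qv (g a) ⬝ᵥ w = 0}
  let f : (Fin k → ℚ) → ℕ := fun w => Set.ncard {a | qv (g a) ⬝ᵥ w ≠ 0}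
  have hS : S.Nonempty := ⟨w₀, hw₀, hC, hZ⟩
  obtain ⟨w, ⟨hw0, hwC, hwZ⟩, hmin⟩ := (measure f).wf.has_min S hS
  -- moving along a bad direction is impossible
  have hbad : ∀ d : Fin k → ℚ, (∀ a, qv (g a) ⬝ᵥ w = 0 → qv (g a) ⬝ᵥ d = 0) →
      (∃ a, qv (g a) ⬝ᵥ d < 0) → ∃ c : ℚ, d = c • w := by
    intro d hd hneg
    by_contra hcon
    obtain ⟨t, ht, hin, a, ha, hat⟩ := cs_move g (fun _ => 0) w d hwC
      (fun a ha => (hd a ha).ge) hneg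
    have hmem : w + t • d ∈ S := by
      refine ⟨?_, hin, ?_⟩
      · intro h0
        apply hcon
        refine ⟨-t⁻¹, ?_⟩
        have : t • d = - w := by rw [eq_neg_iff_add_eq_zero, add_comm]; exact h0
        rw [neg_smul, ← smul_neg, ← this, smul_smul, inv_mul_cancel₀ ht.ne', one_smul]
      · intro c hc
        rw [dotProduct_add, dotProduct_smul, hwZ c hc, hd c (hwZ c hc)]; simp
    apply hmin _ hmem
    change f _ < f _
    apply Set.ncard_lt_ncard _ (Set.toFinite _)
    refine ⟨?_, ?_⟩
    · intro c hc h0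
      apply hc
      rw [dotProduct_add, dotProduct_smul, h0, hd c h0]; simp
    · intro hsub
      have : a ∈ {a | qv (g a) ⬝ᵥ w ≠ 0} := by
        intro h0
        have := hd a h0
        linarith
      exact hsub this hat
  have hker : ∀ d : Fin k → ℚ, (∀ a, qv (g a) ⬝ᵥ w = 0 → qv (g a) ⬝ᵥ d = 0) →
      ∃ c : ℚ, d = c • w := by
    intro d hd
    by_cases h1 : ∃ a, qv (g a) ⬝ᵥ d < 0
    · exact hbad d hd h1
    by_cases h2 : ∃ a, qv (g a) ⬝ᵥ (-d) < 0
    · obtain ⟨c, hc⟩ := hbad (-d) (fun a ha => by rw [dotProduct_neg, hd a ha, neg_zero]) h2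
      exact ⟨-c, by rw [neg_smul, ← hc, neg_neg]⟩
    · push Not at h1 h2
      refine ⟨0, ?_⟩
      rw [zero_smul]
      apply hpt
      intro a
      have := h2 a
      rw [dotProduct_neg] at this
      have := h1 a
      linarith
  obtain ⟨i₀, hi₀⟩ : ∃ i, w i ≠ 0 := by
    by_contra h; push Not at h; exact hw0 (funext h)
  have hsing : ∀ d : Fin k → ℚ, qv (Pi.single i₀ 1 : Fin k → ℤ) ⬝ᵥ d = d i₀ := by
    intro d
    have : qv (Pi.single i₀ 1 : Fin k → ℤ) = Pi.single i₀ 1 := by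
      ext j; by_cases h : j = i₀
      · subst h; simp [qv]
      · simp [qv, h]
    rw [this]; simp
  obtain ⟨A, hAt, -, hdet⟩ := cs_exists_matrix (k := k) ∅
    (insert (Pi.single i₀ 1) (g '' {a | qv (g a) ⬝ᵥ w = 0})) (Set.empty_subset _)
    (linearIndepOn_empty _ _) (by
      intro d hd
      obtain ⟨c, hc⟩ := hker d (fun a ha => hd _ (Set.mem_insert_of_mem _ ⟨a, ha, rfl⟩))
      have h1 := hd _ (Set.mem_insert _ _)
      rw [hsing, hc] at h1
      simp only [Pi.smul_apply, smul_eq_mul] at h1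
      rcases mul_eq_zero.1 h1 with h | h
      · rw [hc, h, zero_smul]
      · exact absurd h hi₀)
  have hAb : ∀ i j, |A i j| ≤ M := by
    intro i j
    rcases hAt i with h | ⟨a, -, ha⟩
    · rw [h]
      by_cases h2 : j = i₀
      · subst h2; simp; exact_mod_cast hM
      · simp [h2]
    · rw [← ha]; exact hg a j
  let r' : Fin k → ℤ := fun i => ∑ j, A.adjugate i j * (if A j = Pi.single i₀ 1 then 1 else 0)
  have hr' : ∀ i, (A.det : ℚ) * w i = w i₀ * (r' i : ℚ) := by
    intro i
    rw [cs_cramer A w (fun j => w i₀ * (if A j = Pi.single i₀ 1 then 1 else 0)) _ i]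
    · simp only [r']
      push_cast
      rw [Finset.mul_sum]
      apply Finset.sum_congr rfl
      intro j _
      ring
    · intro j
      by_cases h : A j = Pi.single i₀ 1
      · rw [h, hsing]; simp
      · rcases hAt j with h' | ⟨a, ha, ha'⟩
        · exact absurd h' h
        · rw [if_neg h, ← ha', mul_zero]; exact ha
  have hr'b : ∀ i, |r' i| ≤ cB k M := by
    intro i
    calc |r' i| ≤ ∑ j, |A.adjugate i j * (if A j = Pi.single i₀ 1 then 1 else 0)| :=
          Finset.abs_sum_le_sum_abs _ _
      _ ≤ ∑ j : Fin k, ((k.factorial * M ^ k : ℕ) : ℤ) := by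
          apply Finset.sum_le_sum
          intro j _
          have := cs_adj_bound A M hM hAb i j
          split_ifs
          · simpa using this
          · simp only [mul_zero, abs_zero]; positivity
      _ = cB k M := by simp [cB]
  have hdq : (A.det : ℚ) ≠ 0 := by exact_mod_cast hdet
  let μ : ℚ := A.det / w i₀
  have hμ : μ ≠ 0 := div_ne_zero hdq hi₀
  have hqr : qv r' = μ • w := by
    ext i
    simp only [qv, Pi.smul_apply, smul_eq_mul, μ]
    field_simp
    linarith [hr' i]
  obtain ⟨r, hr, hrb⟩ : ∃ r : Fin k → ℤ, (∃ ν : ℚ, 0 < ν ∧ qv r = ν • w) ∧ ∀ i, |r i| ≤ cB k M := by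
    rcases lt_or_gt_of_ne hμ with h | h
    · refine ⟨-r', ⟨-μ, by linarith, ?_⟩, ?_⟩
      · rw [neg_smul, ← hqr]; ext i; simp [qv]
      · intro i; simpa using hr'b i
    · exact ⟨r', ⟨μ, h, hqr⟩, hr'b⟩
  obtain ⟨ν, hν, hr⟩ := hr
  refine ⟨r, ?_, ?_, ?_, hrb⟩
  · intro h0
    have : qv r = 0 := by rw [h0]; ext i; simp [qv]
    rw [this] at hr
    exact (smul_ne_zero hν.ne' hw0) hr.symm
  · intro a; rw [hr, dotProduct_smul, smul_eq_mul]; exact mul_nonneg hν.le (hwC a)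
  · intro a ha; rw [hr, dotProduct_smul, hwZ a ha, smul_zero]

open Matrix in
lemma cs_vertex {k : ℕ} {κ : Type*} [Finite κ] (g : κ → Fin k → ℤ) (M : ℕ) (hM : 1 ≤ M)
    (hg : ∀ a i, |g a i| ≤ M) (β : κ → ℚ) (T : ℚ) (hβ : ∀ a, |β a| ≤ T) :
    ∀ (N : ℕ) (w : Fin k → ℚ), Set.ncard {a | qv (g a) ⬝ᵥ w ≠ β a} = N →
    (∀ a, β a ≤ qv (g a) ⬝ᵥ w) →
    (∀ d : Fin k → ℚ, (∀ a, 0 ≤ qv (g a) ⬝ᵥ d) →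
      (∀ a, qv (g a) ⬝ᵥ w = β a → qv (g a) ⬝ᵥ d = 0) → d = 0) →
    ∀ i, |w i| ≤ cB k M * T := by
  intro N
  induction N using Nat.strong_induction_on with
  | _ N ih =>
  intro w hN hw hno i
  by_cases hker : ∀ d : Fin k → ℚ, (∀ a, qv (g a) ⬝ᵥ w = β a → qv (g a) ⬝ᵥ d = 0) → d = 0
  · obtain ⟨A, hAt, -, hdet⟩ := cs_exists_matrix (k := k) ∅
      (g '' {a | qv (g a) ⬝ᵥ w = β a}) (Set.empty_subset _)
      (linearIndepOn_empty _ _) (by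
        intro d hd
        exact hker d (fun a ha => hd _ ⟨a, ha, rfl⟩))
    choose a ha hag using hAt
    have hAb : ∀ i j, |A i j| ≤ M := by
      intro i j
      rw [← hag]; exact hg _ j
    have hcr := cs_cramer A w (fun j => β (a j)) (fun j => by rw [← hag]; exact ha j) i
    have hd1 : (1 : ℚ) ≤ |(A.det : ℚ)| := by
      have : (1 : ℤ) ≤ |A.det| := Int.one_le_abs hdet
      exact_mod_cast this
    calc |w i| ≤ |(A.det : ℚ)| * |w i| := le_mul_of_one_le_left (abs_nonneg _) hd1
      _ = |∑ j, (A.adjugate i j : ℚ) * β (a j)| := by rw [← hcr, abs_mul]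
      _ ≤ ∑ j, |(A.adjugate i j : ℚ) * β (a j)| := Finset.abs_sum_le_sum_abs _ _
      _ ≤ ∑ j : Fin k, ((k.factorial * M ^ k : ℕ) : ℚ) * T := by
          apply Finset.sum_le_sum
          intro j _
          rw [abs_mul]
          have h1 := cs_adj_bound A M hM hAb i j
          have h2 : |(A.adjugate i j : ℚ)| ≤ ((k.factorial * M ^ k : ℕ) : ℚ) := by exact_mod_cast h1
          exact mul_le_mul h2 (hβ _) (abs_nonneg _) (by positivity)
      _ = cB k M * T := by simp [cB]; ring
  · push Not at hker
    obtain ⟨d, hd, hd0⟩ := hker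
    have key : ∀ d : Fin k → ℚ, (∀ a, qv (g a) ⬝ᵥ w = β a → qv (g a) ⬝ᵥ d = 0) → d ≠ 0 →
        ∃ t : ℚ, 0 < t ∧ |(w + t • d) i| ≤ cB k M * T := by
      intro d hd hd0
      have hneg : ∃ a, qv (g a) ⬝ᵥ d < 0 := by
        by_contra h
        push Not at h
        exact hd0 (hno d h hd)
      obtain ⟨t, ht, hin, a, ha, hat⟩ := cs_move g β w d hw (fun a ha => (hd a ha).ge) hneg
      refine ⟨t, ht, ?_⟩
      have htight : ∀ c, qv (g c) ⬝ᵥ w = β c → qv (g c) ⬝ᵥ (w + t • d) = β c := by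
        intro c hc
        rw [dotProduct_add, dotProduct_smul, hd c hc, hc]; simp
      apply ih _ _ (w + t • d) rfl hin
      · intro d' hd' hd''
        exact hno d' hd' (fun c hc => hd'' c (htight c hc))
      · rw [← hN]
        apply Set.ncard_lt_ncard _ (Set.toFinite _)
        refine ⟨?_, ?_⟩
        · intro c hc h0
          exact hc (htight c h0)
        · intro hsub
          have : a ∈ {a | qv (g a) ⬝ᵥ w ≠ β a} := by
            intro h0
            have := hd a h0
            linarith
          exact hsub this hat
    obtain ⟨t, ht, h1⟩ := key d hd hd0
    obtain ⟨s, hs, h2⟩ := key (-d) (fun a ha => by rw [dotProduct_neg, hd a ha, neg_zero])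
      (neg_ne_zero.2 hd0)
    simp only [Pi.add_apply, Pi.smul_apply, smul_eq_mul, Pi.neg_apply] at h1 h2
    rw [abs_le] at h1 h2 ⊢
    constructor
    · by_contra hc
      push Not at hc
      have e1 := h1.1
      have e2 := h2.1
      rcases le_total 0 (d i) with h | h
      · have := mul_nonneg hs.le h; linarith
      · have := mul_nonneg ht.le (neg_nonneg.2 h); linarith
    · by_contra hc
      push Not at hc
      have e1 := h1.2
      have e2 := h2.2
      rcases le_total 0 (d i) with h | h
      · have := mul_nonneg ht.le h; linarith
      · have := mul_nonneg hs.le (neg_nonneg.2 h); linarith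

/-- kernel of the tight constraints -/
def cKer {k : ℕ} {κ : Type*} (g : κ → Fin k → ℤ) (Z : Set κ) : Submodule ℚ (Fin k → ℚ) where
  carrier := {w | ∀ a ∈ Z, qv (g a) ⬝ᵥ w = 0}
  zero_mem' := by intro a _; simp
  add_mem' := by
    intro x y hx hy a ha
    rw [dotProduct_add, hx a ha, hy a ha, add_zero]
  smul_mem' := by
    intro c x hx a ha
    rw [dotProduct_smul, hx a ha, smul_zero]

open Matrix in
lemma cs_peel {k : ℕ} {κ : Type*} [Finite κ] (g : κ → Fin k → ℤ) (M : ℕ) (hM : 1 ≤ M)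
    (hg : ∀ a i, |g a i| ≤ M)
    (hpt : ∀ w : Fin k → ℚ, (∀ a, qv (g a) ⬝ᵥ w = 0) → w = 0)
    (β : κ → ℚ) (T : ℚ) (hβ : ∀ a, |β a| ≤ T) :
    ∀ (N : ℕ) (w : Fin k → ℚ),
    Module.finrank ℚ (cKer g {a | qv (g a) ⬝ᵥ w = β a}) ≤ N →
    (∀ a, β a ≤ qv (g a) ⬝ᵥ w) →
    ∃ (r : Fin N → Fin k → ℤ) (t : Fin N → ℚ) (u : Fin k → ℚ),
      w = u + ∑ j, t j • qv (r j) ∧ (∀ j, 0 ≤ t j) ∧ (∀ j a, 0 ≤ qv (g a) ⬝ᵥ qv (r j)) ∧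
      (∀ j i, |r j i| ≤ cB k M) ∧ (∀ a, β a ≤ qv (g a) ⬝ᵥ u) ∧ (∀ i, |u i| ≤ cB k M * T) := by
  intro N
  induction N with
  | zero =>
    intro w hN hw
    refine ⟨fun j => 0, fun j => 0, w, by simp, by simp, by simp, by simp, hw, ?_⟩
    apply cs_vertex g M hM hg β T hβ _ w rfl hw
    intro d _ hd
    have hbot : cKer g {a | qv (g a) ⬝ᵥ w = β a} = ⊥ := Submodule.finrank_eq_zero.1 (by omega)
    have : d ∈ cKer g {a | qv (g a) ⬝ᵥ w = β a} := hd
    rw [hbot] at this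
    simpa using this
  | succ N ih =>
    intro w hN hw
    by_cases hno : ∀ d : Fin k → ℚ, (∀ a, 0 ≤ qv (g a) ⬝ᵥ d) →
      (∀ a, qv (g a) ⬝ᵥ w = β a → qv (g a) ⬝ᵥ d = 0) → d = 0
    · have hq0 : qv (0 : Fin k → ℤ) = 0 := by ext i; simp [qv]
      refine ⟨fun j => 0, fun j => 0, w, by simp, by simp, by simp [hq0], by simp, hw, ?_⟩
      exact cs_vertex g M hM hg β T hβ _ w rfl hw hno
    · push Not at hno
      obtain ⟨d, hdC, hdZ, hd0⟩ := hno
      obtain ⟨r, hr0, hrC, hrZ, hrb⟩ := cs_ray g M hM hg hpt {a | qv (g a) ⬝ᵥ w = β a} d hd0 hdC hdZ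
      have hqr0 : qv r ≠ 0 := by
        intro h
        apply hr0
        ext i
        have := congrFun h i
        simpa [qv] using this
      have hneg : ∃ a, qv (g a) ⬝ᵥ (-qv r) < 0 := by
        by_contra h
        push Not at h
        apply hqr0
        apply hpt
        intro a
        have h1 := h a
        rw [dotProduct_neg] at h1
        linarith [hrC a]
      have hz : ∀ a, qv (g a) ⬝ᵥ w = β a → qv (g a) ⬝ᵥ (-qv r) = 0 := by
        intro a ha
        rw [dotProduct_neg, hrZ a ha, neg_zero]
      obtain ⟨t, ht, hin, a, ha, hat⟩ := cs_move g β w (-qv r) hw (fun a ha => (hz a ha).ge) hneg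
      have hlt : cKer g {a | qv (g a) ⬝ᵥ (w + t • (-qv r)) = β a} <
          cKer g {a | qv (g a) ⬝ᵥ w = β a} := by
        refine lt_of_le_of_ne ?_ ?_
        · intro y hy c hc
          apply hy c
          change _ = _
          have hc' : qv (g c) ⬝ᵥ w = β c := hc
          rw [dotProduct_add, dotProduct_smul, hz c hc, hc']; simp
        · intro heq
          have h1 : qv r ∈ cKer g {a | qv (g a) ⬝ᵥ w = β a} := hrZ
          rw [← heq] at h1
          have h2 := h1 a hat
          rw [dotProduct_neg, h2] at ha
          simp at ha
      have hfr := Submodule.finrank_lt_finrank_of_lt hlt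
      obtain ⟨r', t', u, hw', ht', hr'C, hr'b, hu, hub⟩ := ih (w + t • (-qv r)) (by omega) hin
      refine ⟨Fin.cons r r', Fin.cons t t', u, ?_, ?_, ?_, ?_, hu, hub⟩
      · rw [Fin.sum_univ_succ]
        simp only [Fin.cons_zero, Fin.cons_succ]
        have : w = (w + t • (-qv r)) + t • qv r := by rw [smul_neg]; abel
        rw [this, hw']
        abel
      · intro j; refine Fin.cases ?_ ?_ j
        · exact ht.le
        · intro j; exact ht' j
      · intro j; refine Fin.cases ?_ ?_ j
        · exact hrC
        · intro j; exact hr'C j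
      · intro j; refine Fin.cases ?_ ?_ j
        · exact hrb
        · intro j; exact hr'b j

/-- cast to integers -/
def nv {k : ℕ} (z : Fin k → ℕ) : Fin k → ℤ := fun i => (z i : ℤ)

lemma cs_qdot {k : ℕ} (h z : Fin k → ℤ) : qv h ⬝ᵥ qv z = ((h ⬝ᵥ z : ℤ) : ℚ) := by
  simp [qv, dotProduct]

lemma cs_sdot {k : ℕ} (i : Fin k) (z : Fin k → ℤ) : (Pi.single i 1 : Fin k → ℤ) ⬝ᵥ z = z i := by
  simp

/-- same type with respect to all small functionals -/
def cSame {k : ℕ} (M T : ℕ) (v v' : Fin k → ℕ) : Prop :=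
  ∀ h : Fin k → ℤ, (∀ i, |h i| ≤ M) → h ⬝ᵥ nv v' = h ⬝ᵥ nv v ∨
    ((T : ℤ) < h ⬝ᵥ nv v ∧ (T : ℤ) < h ⬝ᵥ nv v') ∨
    (h ⬝ᵥ nv v < -(T : ℤ) ∧ h ⬝ᵥ nv v' < -(T : ℤ))

lemma cs_pump {k : ℕ} (M : ℕ) (hM : 1 ≤ M) (T D : ℕ) (hD : 1 ≤ D) (v : Fin k → ℕ) :
    ∃ (r : Fin k → Fin k → ℕ) (c q : Fin k → ℕ),
      v = c + ∑ j, q j • (D • r j) ∧ (∀ j i, r j i ≤ cB k M) ∧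
      (∀ i, c i ≤ cB k M * (T + 1) + k * (D * cB k M)) ∧
      ∀ q' : Fin k → ℕ, cSame M T v (c + ∑ j, q' j • (D • r j)) := by
  let S : Set (Fin k → ℤ) := {h | (∀ i, |h i| ≤ M) ∧ -(T : ℤ) ≤ h ⬝ᵥ nv v}
  have hSf : S.Finite := by
    apply Set.Finite.subset (Set.finite_Icc (fun _ => -(M : ℤ)) (fun _ => (M : ℤ)))
    intro h hh
    exact ⟨fun i => (abs_le.1 (hh.1 i)).1, fun i => (abs_le.1 (hh.1 i)).2⟩
  have : Finite S := hSf
  have hsing : ∀ i, (Pi.single i 1 : Fin k → ℤ) ∈ S := by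
    intro i
    refine ⟨?_, ?_⟩
    · intro j
      by_cases h2 : j = i
      · subst h2; simp; exact_mod_cast hM
      · simp [h2]
    · rw [cs_sdot]; simp only [nv]; omega
  let g : S → Fin k → ℤ := fun h => h
  let β : S → ℤ := fun h => min (g h ⬝ᵥ nv v) (T + 1)
  have hqsing : ∀ i (w : Fin k → ℚ), qv (Pi.single i 1 : Fin k → ℤ) ⬝ᵥ w = w i := by
    intro i d
    have : qv (Pi.single i 1 : Fin k → ℤ) = Pi.single i 1 := by
      ext j; by_cases h : j = i
      · subst h; simp [qv]
      · simp [qv, h]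
    rw [this]; simp
  have hpt : ∀ w : Fin k → ℚ, (∀ a, qv (g a) ⬝ᵥ w = 0) → w = 0 := by
    intro w hw
    ext i
    have := hw ⟨_, hsing i⟩
    simp only [g] at this
    rw [hqsing] at this
    simpa using this
  obtain ⟨r, t, u, hv, ht, hrC, hrb, hu, hub⟩ := cs_peel g M hM (fun a => a.2.1) hpt
    (fun a => (β a : ℚ)) ((T : ℚ) + 1) (by
      intro a
      have h1 : |β a| ≤ (T : ℤ) + 1 := by
        rw [abs_le]
        have := a.2.2
        simp only [β, g]
        constructor
        · apply le_min <;> omega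
        · exact min_le_right _ _
      exact_mod_cast h1) k (qv (nv v)) (by
        refine (Submodule.finrank_le _).trans ?_
        simp) (by
        intro a
        rw [cs_qdot]
        exact_mod_cast min_le_left _ _)
  have hrC' : ∀ j (a : S), 0 ≤ g a ⬝ᵥ r j := by
    intro j a
    have := hrC j a
    rw [cs_qdot] at this
    exact_mod_cast this
  have hr0 : ∀ j i, 0 ≤ r j i := by
    intro j i
    have := hrC' j ⟨_, hsing i⟩
    simpa only [g, cs_sdot] using this
  have hDq : (0 : ℚ) < D := by exact_mod_cast hD
  let q : Fin k → ℕ := fun j => ⌊t j / D⌋₊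
  have hq1 : ∀ j, (q j : ℚ) * D ≤ t j := by
    intro j
    have := Nat.floor_le (div_nonneg (ht j) hDq.le)
    rwa [le_div_iff₀ hDq] at this
  have hq2 : ∀ j, t j - (q j : ℚ) * D ≤ D := by
    intro j
    have := Nat.lt_floor_add_one (t j / D)
    rw [div_lt_iff₀ hDq] at this
    have h3 : t j < ((q j : ℚ) + 1) * D := this
    linarith
  let cZ : Fin k → ℤ := nv v - ∑ j, ((q j : ℤ) * D) • r j
  have hcq : qv cZ = u + ∑ j, (t j - (q j : ℚ) * D) • qv (r j) := by
    ext i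
    have h1 := congrFun hv i
    simp only [qv, cZ, Pi.add_apply, Pi.sub_apply, Finset.sum_apply, Pi.smul_apply, smul_eq_mul] at h1 ⊢
    push_cast
    rw [h1]
    simp only [sub_mul, Finset.sum_sub_distrib]
    ring
  have hcβ : ∀ a : S, β a ≤ g a ⬝ᵥ cZ := by
    intro a
    have h1 : (β a : ℚ) ≤ qv (g a) ⬝ᵥ qv cZ := by
      rw [hcq, dotProduct_add, dotProduct_sum]
      have h2 : 0 ≤ ∑ j, qv (g a) ⬝ᵥ ((t j - (q j : ℚ) * D) • qv (r j)) := by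
        apply Finset.sum_nonneg
        intro j _
        rw [dotProduct_smul, smul_eq_mul]
        exact mul_nonneg (by linarith [hq1 j]) (hrC j a)
      linarith [hu a]
    rw [cs_qdot] at h1
    exact_mod_cast h1
  have hc0 : ∀ i, 0 ≤ cZ i := by
    intro i
    have h1 := hcβ ⟨_, hsing i⟩
    simp only [β, g, cs_sdot] at h1
    refine le_trans ?_ h1
    apply le_min
    · simp [nv]
    · positivity
  have hcb : ∀ i, (cZ i : ℚ) ≤ ((cB k M * (T + 1) + k * (D * cB k M) : ℕ) : ℚ) := by
    intro i
    have h1 := congrFun hcq i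
    simp only [qv, Pi.add_apply, Finset.sum_apply, Pi.smul_apply, smul_eq_mul] at h1
    rw [h1]
    have h2 : ∑ j, (t j - (q j : ℚ) * D) * (r j i : ℚ) ≤ ∑ j : Fin k, (D : ℚ) * cB k M := by
      apply Finset.sum_le_sum
      intro j _
      have h3 : ((r j i : ℤ) : ℚ) ≤ cB k M := by exact_mod_cast (abs_le.1 (hrb j i)).2
      have h4 : (0 : ℚ) ≤ r j i := by exact_mod_cast hr0 j i
      exact mul_le_mul (hq2 j) h3 h4 hDq.le
    have h5 := (abs_le.1 (hub i)).2
    simp only [Finset.sum_const, Finset.card_univ, Fintype.card_fin, nsmul_eq_mul] at h2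
    push_cast
    linarith
  refine ⟨fun j i => (r j i).toNat, fun i => (cZ i).toNat, q, ?_, ?_, ?_, ?_⟩
  · ext i
    zify
    simp only [Pi.add_apply, Finset.sum_apply, Pi.smul_apply, smul_eq_mul]
    push_cast
    rw [Int.toNat_of_nonneg (hc0 i)]
    simp only [cZ, Pi.sub_apply, Finset.sum_apply, Pi.smul_apply, smul_eq_mul, nv]
    have : ∀ j, (q j : ℤ) * (D * ((r j i).toNat : ℤ)) = (q j : ℤ) * D * r j i := by
      intro j; rw [Int.toNat_of_nonneg (hr0 j i)]; ring
    push_cast [Int.toNat_of_nonneg (hr0 _ i)]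
    simp only [mul_assoc]
    ring
  · intro j i
    have := (abs_le.1 (hrb j i)).2
    simp only; omega
  · intro i
    have h1 : cZ i ≤ ((cB k M * (T + 1) + k * (D * cB k M) : ℕ) : ℤ) := by exact_mod_cast hcb i
    simp only; omega
  · intro q'
    set z := nv ((fun i => (cZ i).toNat) + ∑ j, q' j • (D • fun i => (r j i).toNat)) with hz
    have hz' : z = cZ + ∑ j, ((q' j : ℤ) * D) • r j := by
      ext i
      simp only [hz, nv, Pi.add_apply, Finset.sum_apply, Pi.smul_apply, smul_eq_mul]
      push_cast
      simp only [Int.toNat_of_nonneg (hr0 _ i), Int.toNat_of_nonneg (hc0 i), mul_assoc]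
    have hzβ : ∀ a : S, β a ≤ g a ⬝ᵥ z := by
      intro a
      rw [hz', dotProduct_add, dotProduct_sum]
      have h2 : 0 ≤ ∑ j, g a ⬝ᵥ (((q' j : ℤ) * D) • r j) := by
        apply Finset.sum_nonneg
        intro j _
        rw [dotProduct_smul, smul_eq_mul]
        exact mul_nonneg (by positivity) (hrC' j a)
      linarith [hcβ a]
    intro h hh
    rw [← hz]
    have hpos : -(T : ℤ) ≤ h ⬝ᵥ nv v → min (h ⬝ᵥ nv v) (T + 1) ≤ h ⬝ᵥ z := by
      intro h1
      exact hzβ ⟨h, hh, h1⟩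
    have hneg : h ⬝ᵥ nv v ≤ T → min (-(h ⬝ᵥ nv v)) (T + 1) ≤ -(h ⬝ᵥ z) := by
      intro h1
      have := hzβ ⟨-h, fun i => by simpa using hh i, by rw [neg_dotProduct]; omega⟩
      simpa only [β, g, neg_dotProduct] using this
    omega

open Matrix in
lemma cs_adj_sum {k : ℕ} (A : Matrix (Fin k) (Fin k) ℤ) (z : Fin k → ℤ) :
    ∑ j, ((fun i => A.adjugate i j) ⬝ᵥ z) • A j = A.det • z := by
  have h : (z ᵥ* A.adjugate) ᵥ* A = A.det • z := by
    rw [vecMul_vecMul, adjugate_mul, vecMul_smul, vecMul_one]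
  rw [← h]
  ext i
  simp only [Finset.sum_apply, Pi.smul_apply, smul_eq_mul, vecMul, dotProduct]
  apply Finset.sum_congr rfl
  intro j _
  congr 1
  apply Finset.sum_congr rfl
  intro l _
  ring

open Matrix in
lemma cs_adj_row {k : ℕ} (A : Matrix (Fin k) (Fin k) ℤ) (i j : Fin k) :
    (fun i => A.adjugate i j) ⬝ᵥ A i = if i = j then A.det else 0 := by
  have h := congrFun (congrFun (mul_adjugate A) i) j
  rw [mul_apply, Matrix.smul_apply, one_apply] at h
  rw [dotProduct]
  simp only [mul_comm]
  rw [h]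
  split_ifs <;> simp

lemma cs_basis {k : ℕ} (n : ℕ) (S : Finset (Fin k → ℕ)) (hS : ∀ s ∈ S, ∀ i, s i ≤ n)
    (hli : LinearIndepOn ℚ (fun s : Fin k → ℕ => qv (nv s)) (S : Set (Fin k → ℕ))) :
    ∃ A : Matrix (Fin k) (Fin k) ℤ, (∀ i j, |A i j| ≤ ((n + 1 : ℕ) : ℤ)) ∧
      (∀ s ∈ S, ∃ i, A i = nv s) ∧ A.det ≠ 0 := by
  obtain ⟨A, hAt, hAs, hdet⟩ := cs_exists_matrix (k := k) (nv '' (S : Set (Fin k → ℕ)))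
    (nv '' (S : Set (Fin k → ℕ)) ∪ Set.range (fun i => (Pi.single i 1 : Fin k → ℤ)))
    Set.subset_union_left (LinearIndepOn.image_of_comp nv qv hli) (by
      intro w hw
      ext i
      have h1 := hw _ (Or.inr ⟨i, rfl⟩)
      have : qv (Pi.single i 1 : Fin k → ℤ) = Pi.single i 1 := by
        ext j; by_cases h : j = i
        · subst h; simp [qv]
        · simp [qv, h]
      simp only at h1
      rw [this] at h1
      simpa using h1)
  refine ⟨A, ?_, fun s hs => hAs _ ⟨s, hs, rfl⟩, hdet⟩
  intro i j
  rcases hAt i with ⟨s, hs, h⟩ | ⟨l, h⟩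
  · rw [← h]
    have := hS s hs j
    simp only [nv, Nat.abs_cast]
    exact_mod_cast this.trans (Nat.le_succ _)
  · rw [← h]
    by_cases h2 : j = l
    · subst h2; simp
    · simp [h2]; positivity

lemma nv_inj {k : ℕ} {s s' : Fin k → ℕ} (h : nv s = nv s') : s = s' := by
  ext i
  have := congrFun h i
  simpa [nv] using this

lemma cs_regroup {k : ℕ} (S : Finset (Fin k → ℕ)) (A : Fin k → Fin k → ℤ) (l : Fin k → ℤ)
    (hl2 : ∀ j, l j ≠ 0 → ∃ s ∈ S, A j = nv s) :
    ∑ s ∈ S, (∑ j, if A j = nv s then l j else 0) • nv s = ∑ j, l j • A j := by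
  simp only [Finset.sum_smul]
  rw [Finset.sum_comm]
  apply Finset.sum_congr rfl
  intro j _
  by_cases h0 : l j = 0
  · simp [h0]
  · obtain ⟨s, hs, hAj⟩ := hl2 j h0
    rw [Finset.sum_eq_single s]
    · rw [if_pos hAj, hAj]
    · intro s' _ hne
      rw [if_neg, zero_smul]
      intro h
      exact hne (nv_inj (h.symm.trans hAj))
    · intro h; exact absurd hs h

/-- the determinant bound -/
def cM (k n : ℕ) : ℕ := k.factorial * (n + 1) ^ k

lemma cs_member {k : ℕ} (hk : 1 ≤ k) (n T D : ℕ) (S : Finset (Fin k → ℕ)) (hS : ∀ s ∈ S, ∀ i, s i ≤ n)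
    (hli : LinearIndepOn ℚ (fun s : Fin k → ℕ => qv (nv s)) (S : Set (Fin k → ℕ)))
    (c : Fin k → ℕ) (hc : ∀ h : Fin k → ℤ, (∀ i, |h i| ≤ cM k n) → |h ⬝ᵥ nv c| ≤ T)
    (hD : ∀ d : ℕ, 1 ≤ d → d ≤ cM k n → d ∣ D)
    (v v' : Fin k → ℕ) (hsame : cSame (cM k n) T v v') (hmod : ∀ i, (D : ℤ) ∣ nv v' i - nv v i)
    (lam : (Fin k → ℕ) → ℕ) (hv : v = c + ∑ s ∈ S, lam s • s) :
    ∃ lam' : (Fin k → ℕ) → ℕ, v' = c + ∑ s ∈ S, lam' s • s := by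
  classical
  obtain ⟨A, hAb, hAs, hdet⟩ := cs_basis n S hS hli
  have hdetb := cs_det_bound A (n + 1) hAb
  have hadjb := cs_adj_bound A (n + 1) (by omega) hAb
  have hdD : A.det ∣ (D : ℤ) := by
    have h1 : A.det.natAbs ∣ D := by
      apply hD
      · exact Int.natAbs_pos.2 hdet
      · have : (A.det.natAbs : ℤ) ≤ (k.factorial * (n + 1) ^ k : ℕ) := by rw [Int.natCast_natAbs]; exact hdetb
        exact_mod_cast this
    exact Int.natAbs_dvd.1 (by exact_mod_cast h1)
  have : Nonempty (Fin k) := ⟨⟨0, hk⟩⟩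
  choose! idx hidx using hAs
  have hvz : nv v = nv c + ∑ s ∈ S, (lam s : ℤ) • nv s := by
    rw [hv]; ext i; simp [nv]
  -- coordinates of v - c
  have hl : ∀ j, ∃ l : ℤ, 0 ≤ l ∧ (fun i => A.adjugate i j) ⬝ᵥ (nv v - nv c) = A.det * l ∧
      (l ≠ 0 → ∃ s ∈ S, A j = nv s) := by
    intro j
    refine ⟨∑ s ∈ S, if idx s = j then (lam s : ℤ) else 0, ?_, ?_, ?_⟩
    · apply Finset.sum_nonneg; intro s _; split_ifs <;> positivity
    · rw [hvz, add_sub_cancel_left, dotProduct_sum, Finset.mul_sum]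
      apply Finset.sum_congr rfl
      intro s hs
      rw [dotProduct_smul, ← hidx s hs, cs_adj_row, smul_eq_mul]
      split_ifs <;> ring
    · intro h
      obtain ⟨s, hs, h1⟩ := Finset.exists_ne_zero_of_sum_ne_zero h
      refine ⟨s, hs, ?_⟩
      by_cases h2 : idx s = j
      · rw [← h2]; exact hidx s hs
      · simp [h2] at h1
  have hl' : ∀ j, ∃ l : ℤ, 0 ≤ l ∧ (fun i => A.adjugate i j) ⬝ᵥ (nv v' - nv c) = A.det * l ∧
      (l ≠ 0 → ∃ s ∈ S, A j = nv s) := by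
    intro j
    obtain ⟨l, hl0, hl1, hl2⟩ := hl j
    have hcj := abs_le.1 (hc (fun i => A.adjugate i j) (fun i => hadjb i j))
    have hdiv : A.det ∣ (fun i => A.adjugate i j) ⬝ᵥ nv v' - (fun i => A.adjugate i j) ⬝ᵥ nv v := by
      rw [← dotProduct_sub]
      apply Finset.dvd_sum
      intro i _
      exact Dvd.dvd.mul_left (hdD.trans (hmod i)) _
    obtain ⟨e, he⟩ := hdiv
    rw [dotProduct_sub] at hl1 ⊢
    rcases hsame (fun i => A.adjugate i j) (fun i => hadjb i j) with h | ⟨h1, h2⟩ | ⟨h1, h2⟩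
    · exact ⟨l, hl0, by rw [h]; exact hl1, hl2⟩
    · have hp : 0 < A.det * l := by omega
      have hp2 : 0 < A.det * (l + e) := by rw [mul_add]; omega
      have hdp : 0 < A.det := pos_of_mul_pos_left hp hl0
      refine ⟨l + e, (pos_of_mul_pos_right hp2 hdp.le).le, by rw [mul_add]; omega, fun _ => hl2 ?_⟩
      rintro rfl
      simp at hp
    · have hp : 0 < (-A.det) * l := by rw [neg_mul]; omega
      have hp2 : 0 < (-A.det) * (l + e) := by rw [neg_mul, mul_add]; omega
      have hdp : 0 < -A.det := pos_of_mul_pos_left hp hl0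
      refine ⟨l + e, (pos_of_mul_pos_right hp2 hdp.le).le, by rw [mul_add]; omega, fun _ => hl2 ?_⟩
      rintro rfl
      simp at hp
  choose l hl0 hl1 hl2 using hl'
  have hsum : nv v' - nv c = ∑ j, l j • A j := by
    have h1 := cs_adj_sum A (nv v' - nv c)
    simp only [hl1] at h1
    simp only [mul_smul] at h1
    rw [← Finset.smul_sum] at h1
    exact (smul_right_injective _ hdet h1).symm
  let L : (Fin k → ℕ) → ℤ := fun s => ∑ j, if A j = nv s then l j else 0
  have hL0 : ∀ s, 0 ≤ L s := by
    intro s; apply Finset.sum_nonneg; intro j _; split_ifs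
    · exact hl0 j
    · exact le_rfl
  have hLs : ∑ s ∈ S, L s • nv s = ∑ j, l j • A j := cs_regroup S A l hl2
  refine ⟨fun s => (L s).toNat, ?_⟩
  apply nv_inj
  rw [← hLs] at hsum
  have h2 : nv v' = nv c + ∑ s ∈ S, L s • nv s := by rw [← hsum]; abel
  rw [h2]
  ext i
  simp only [nv, Pi.add_apply, Finset.sum_apply, Pi.smul_apply, smul_eq_mul]
  push_cast
  simp only [Int.toNat_of_nonneg (hL0 _)]

/-- bound for coefficients of relations -/
def cK (k n : ℕ) : ℕ := k * (k * (cM k n * (n + 1)))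

lemma cM_pos (k n : ℕ) : 1 ≤ cM k n := Nat.mul_pos (Nat.factorial_pos _) (by positivity)

lemma cs_relation {k : ℕ} (hk : 1 ≤ k) (n : ℕ) (S : Finset (Fin k → ℕ))
    (hS : ∀ s ∈ S, ∀ i, s i ≤ n)
    (hli : ¬ LinearIndepOn ℚ (fun s : Fin k → ℕ => qv (nv s)) (S : Set (Fin k → ℕ))) :
    ∃ a : (Fin k → ℕ) → ℤ, ∑ s ∈ S, a s • nv s = 0 ∧ (∀ s ∈ S, a s ≤ cK k n) ∧
      ∃ p ∈ S, 0 < a p := by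
  classical
  obtain ⟨b, hbS, -, hspan, hb⟩ := exists_linearIndepOn_extension
    (linearIndepOn_empty ℚ (fun s : Fin k → ℕ => qv (nv s)))
    (Set.empty_subset (S : Set (Fin k → ℕ)))
  obtain ⟨p, hpS, hpb⟩ : ∃ p ∈ S, p ∉ b := by
    by_contra h
    push Not at h
    exact hli (hb.mono h)
  let S0 : Finset (Fin k → ℕ) := S.filter (· ∈ b)
  have hS0 : (S0 : Set (Fin k → ℕ)) = b := by
    ext s; simp only [S0, Finset.coe_filter, Set.mem_ofPred_eq]
    exact ⟨fun h => h.2, fun h => ⟨hbS h, h⟩⟩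
  obtain ⟨A, hAb, hAs, hdet⟩ := cs_basis n S0 (fun s hs => hS s (Finset.mem_filter.1 hs).1)
    (by rw [hS0]; exact hb)
  have hdetb := cs_det_bound A (n + 1) hAb
  have hadjb := cs_adj_bound A (n + 1) (by omega) hAb
  let l : Fin k → ℤ := fun j => (fun i => A.adjugate i j) ⬝ᵥ nv p
  have hl2 : ∀ j, l j ≠ 0 → ∃ s ∈ S0, A j = nv s := by
    intro j hj
    by_contra hcon
    push Not at hcon
    apply hj
    have h1 : qv (nv p) ∈ Submodule.span ℚ ((fun s : Fin k → ℕ => qv (nv s)) '' b) :=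
      hspan ⟨p, hpS, rfl⟩
    have h2 : ∀ y ∈ Submodule.span ℚ ((fun s : Fin k → ℕ => qv (nv s)) '' b),
        qv (fun i => A.adjugate i j) ⬝ᵥ y = 0 := by
      intro y hy
      induction hy using Submodule.span_induction with
      | mem y hy =>
        obtain ⟨s, hs, rfl⟩ := hy
        have hs0 : s ∈ S0 := by
          rw [← hS0] at hs; exact hs
        obtain ⟨i, hi⟩ := hAs s hs0
        simp only
        rw [cs_qdot, ← hi, cs_adj_row, if_neg]
        · simp
        · rintro rfl
          exact hcon s hs0 hi
      | zero => simp
      | add x y _ _ hx hy => rw [dotProduct_add, hx, hy, add_zero]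
      | smul c x _ hx => rw [dotProduct_smul, hx, smul_zero]
    have h3 := h2 _ h1
    rw [cs_qdot] at h3
    exact_mod_cast h3
  have hlb : ∀ j, |l j| ≤ (k * (cM k n * (n + 1)) : ℕ) := by
    intro j
    calc |l j| ≤ ∑ i, |A.adjugate i j * nv p i| := Finset.abs_sum_le_sum_abs _ _
      _ ≤ ∑ i : Fin k, ((cM k n * (n + 1) : ℕ) : ℤ) := by
        apply Finset.sum_le_sum
        intro i _
        rw [abs_mul]
        push_cast
        have h1 : |nv p i| ≤ (n : ℤ) + 1 := by
          have := hS p hpS i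
          simp only [nv, Nat.abs_cast]; omega
        exact mul_le_mul (hadjb i j) h1 (abs_nonneg _) (by positivity)
      _ = _ := by simp
  let L : (Fin k → ℕ) → ℤ := fun s => ∑ j, if A j = nv s then l j else 0
  have hL : ∑ s ∈ S0, L s • nv s = A.det • nv p := by
    rw [← cs_adj_sum A (nv p)]
    exact cs_regroup S0 A l hl2
  have hLb : ∀ s, |L s| ≤ cK k n := by
    intro s
    calc |L s| ≤ ∑ j, |if A j = nv s then l j else 0| := Finset.abs_sum_le_sum_abs _ _
      _ ≤ ∑ j : Fin k, ((k * (cM k n * (n + 1)) : ℕ) : ℤ) := by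
        apply Finset.sum_le_sum
        intro j _
        split_ifs
        · exact hlb j
        · rw [abs_zero]; positivity
      _ = _ := by simp [cK]
  have hMK : cM k n ≤ cK k n := by
    unfold cK
    calc cM k n = 1 * (1 * (cM k n * 1)) := by ring
      _ ≤ _ := by gcongr; omega
  let ε : ℤ := A.det.sign
  have hε : |ε| = 1 := by
    simp only [ε]
    rcases lt_or_gt_of_ne hdet with h | h
    · rw [Int.sign_eq_neg_one_of_neg h]; simp
    · rw [Int.sign_eq_one_of_pos h]; simp
  have hpS0 : p ∉ S0 := fun h => hpb (Finset.mem_filter.1 h).2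
  refine ⟨fun s => ε * ((if s = p then A.det else 0) - (if s ∈ b then L s else 0)), ?_, ?_, p, hpS, ?_⟩
  · simp only [mul_smul, ← Finset.smul_sum, sub_smul, Finset.sum_sub_distrib]
    have h1 : ∑ s ∈ S, (if s = p then A.det else 0) • nv s = A.det • nv p := by
      rw [Finset.sum_eq_single p]
      · simp
      · intro s _ h; simp [h]
      · intro h; exact absurd hpS h
    have h2 : ∑ s ∈ S, (if s ∈ b then L s else 0) • nv s = A.det • nv p := by
      rw [← hL, Finset.sum_filter]
      apply Finset.sum_congr rfl
      intro s _
      split_ifs <;> simp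
    rw [h1, h2, sub_self, smul_zero]
  · intro s hs
    refine (le_abs_self _).trans ?_
    rw [abs_mul, hε, one_mul]
    by_cases h : s = p
    · subst h
      rw [if_pos rfl, if_neg hpb, sub_zero]
      exact hdetb.trans (by exact_mod_cast hMK)
    · rw [if_neg h]
      split_ifs
      · rw [zero_sub, abs_neg]; exact hLb s
      · simp
  · simp only [if_true, if_neg hpb, sub_zero]
    simp only [ε]
    rw [Int.sign_mul_self_eq_abs]
    exact abs_pos.2 hdet

lemma cs_rep {k : ℕ} (hk : 1 ≤ k) (n : ℕ) (P : Finset (Fin k → ℕ))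
    (hP : ∀ s ∈ P, ∀ i, s i ≤ n) (lam : (Fin k → ℕ) → ℕ) :
    ∃ lam' : (Fin k → ℕ) → ℕ, ∑ p ∈ P, lam' p • p = ∑ p ∈ P, lam p • p ∧
      LinearIndepOn ℚ (fun s : Fin k → ℕ => qv (nv s))
        ((P.filter (fun p => cK k n ≤ lam' p) : Finset _) : Set (Fin k → ℕ)) := by
  classical
  let R : Set ((Fin k → ℕ) → ℕ) := {lam' | ∑ p ∈ P, lam' p • p = ∑ p ∈ P, lam p • p}
  let f : ((Fin k → ℕ) → ℕ) → ℕ := fun lam' => (P.filter (fun p => cK k n ≤ lam' p)).card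
  obtain ⟨lam0, h0, hmin0⟩ := (measure f).wf.has_min R ⟨lam, rfl⟩
  refine ⟨lam0, h0, ?_⟩
  by_contra hli
  set S0 := P.filter (fun p => cK k n ≤ lam0 p) with hS0
  obtain ⟨a, ha0, haK, p, hp, hap⟩ := cs_relation hk n S0
    (fun s hs => hP s (Finset.mem_filter.1 hs).1) hli
  let R2 : Set ((Fin k → ℕ) → ℕ) := {lam' | lam' ∈ R ∧ ∀ q ∈ P, q ∉ S0 → lam' q < cK k n}
  obtain ⟨lam1, ⟨h1, h1'⟩, hmin1⟩ := (measure (fun lam' : (Fin k → ℕ) → ℕ => lam' p)).wf.has_min R2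
    ⟨lam0, h0, fun q hq hqS => by
      by_contra h
      exact hqS (Finset.mem_filter.2 ⟨hq, not_lt.1 h⟩)⟩
  have hsub : P.filter (fun p => cK k n ≤ lam1 p) ⊆ S0 := by
    intro q hq
    by_contra h
    have := h1' q (Finset.mem_filter.1 hq).1 h
    have := (Finset.mem_filter.1 hq).2
    omega
  have heq : P.filter (fun p => cK k n ≤ lam1 p) = S0 := by
    apply Finset.eq_of_subset_of_card_le hsub
    have := hmin0 lam1 h1
    exact not_lt.1 this
  have hbig : ∀ s ∈ S0, cK k n ≤ lam1 s := by
    intro s hs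
    rw [← heq] at hs
    exact (Finset.mem_filter.1 hs).2
  have hnn : ∀ s ∈ S0, 0 ≤ (lam1 s : ℤ) - a s := by
    intro s hs
    have := hbig s hs
    have := haK s hs
    omega
  apply hmin1 (fun q => if q ∈ S0 then ((lam1 q : ℤ) - a q).toNat else lam1 q)
  · refine ⟨?_, ?_⟩
    · change _ = _
      have h1e : ∑ p ∈ P, lam1 p • p = ∑ p ∈ P, lam p • p := h1
      rw [← h1e]
      apply nv_inj
      have hc : ∀ μ : (Fin k → ℕ) → ℕ, nv (∑ p ∈ P, μ p • p) = ∑ p ∈ P, (μ p : ℤ) • nv p := by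
        intro μ; ext i; simp [nv]
      rw [hc, hc, ← sub_eq_zero, ← Finset.sum_sub_distrib]
      have : ∑ s ∈ S0, (-a s) • nv s = 0 := by
        simp only [neg_smul, Finset.sum_neg_distrib, ha0, neg_zero]
      rw [← this, ← Finset.sum_filter_add_sum_filter_not P (· ∈ S0)]
      have e1 : P.filter (· ∈ S0) = S0 := by
        ext s; simp only [Finset.mem_filter, hS0]; tauto
      rw [e1]
      have e2 : ∀ s ∈ P.filter (fun x => ¬ x ∈ S0),
          (((if s ∈ S0 then ((lam1 s : ℤ) - a s).toNat else lam1 s : ℕ)) : ℤ) • nv s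
            - (lam1 s : ℤ) • nv s = 0 := by
        intro s hs
        rw [if_neg (Finset.mem_filter.1 hs).2, sub_self]
      rw [Finset.sum_eq_zero e2, add_zero]
      apply Finset.sum_congr rfl
      intro s hs
      rw [if_pos hs, Int.toNat_of_nonneg (hnn s hs), ← sub_smul]
      congr 1; ring
    · intro q hq hqS
      simp only [if_neg hqS]
      exact h1' q hq hqS
  · change (if p ∈ S0 then ((lam1 p : ℤ) - a p).toNat else lam1 p) < lam1 p
    rw [if_pos hp]
    have := hnn p hp
    omega

/-- threshold -/
def cT (k n m l : ℕ) : ℕ := k * (cM k n * (l + m * (cK k n * n)))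

lemma mem_LSet1 {k : ℕ} {c v : Fin k → ℕ} {P : Finset (Fin k → ℕ)} :
    v ∈ LSet1 c P ↔ ∃ lam : (Fin k → ℕ) → ℕ, v = c + ∑ x ∈ P, lam x • x := by
  simp [LSet1, LSet]

lemma cs_transfer {k : ℕ} (hk : 1 ≤ k) (n m l : ℕ) (x : Fin k → ℕ) (hx : ∀ i, x i ≤ l)
    (P : Finset (Fin k → ℕ)) (hP : ∀ s ∈ P, ∀ i, s i ≤ n) (hm : P.card ≤ m)
    (v v' : Fin k → ℕ) (hsame : cSame (cM k n) (cT k n m l) v v')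
    (hmod : ∀ i, (((cM k n).factorial : ℕ) : ℤ) ∣ nv v' i - nv v i)
    (hv : v ∈ LSet1 x P) : v' ∈ LSet1 x P := by
  classical
  rw [mem_LSet1] at hv ⊢
  obtain ⟨lam, hv⟩ := hv
  obtain ⟨lam', h1, hli⟩ := cs_rep hk n P hP lam
  rw [← h1] at hv
  set S := P.filter (fun p => cK k n ≤ lam' p) with hS
  let c : Fin k → ℕ := x + ∑ p ∈ P.filter (fun p => ¬ cK k n ≤ lam' p), lam' p • p
  have hvc : v = c + ∑ s ∈ S, lam' s • s := by
    rw [hv, ← Finset.sum_filter_add_sum_filter_not P (fun p => cK k n ≤ lam' p)]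
    simp only [c, hS]
    abel
  have hcb : ∀ i, c i ≤ l + m * (cK k n * n) := by
    intro i
    simp only [c, Pi.add_apply, Finset.sum_apply, Pi.smul_apply, smul_eq_mul]
    apply add_le_add (hx i)
    calc _ ≤ ∑ p ∈ P.filter (fun p => ¬ cK k n ≤ lam' p), cK k n * n := by
          apply Finset.sum_le_sum
          intro p hp
          have := Finset.mem_filter.1 hp
          exact Nat.mul_le_mul (not_le.1 this.2).le (hP p this.1 i)
      _ = (P.filter (fun p => ¬ cK k n ≤ lam' p)).card * (cK k n * n) := by simp
      _ ≤ m * (cK k n * n) := Nat.mul_le_mul_right _ ((Finset.card_filter_le _ _).trans hm)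
  obtain ⟨lam2, h2⟩ := cs_member hk n (cT k n m l) (cM k n).factorial S
    (fun s hs => hP s (Finset.mem_filter.1 hs).1) hli c (by
      intro h hh
      calc |h ⬝ᵥ nv c| ≤ ∑ i, |h i * nv c i| := Finset.abs_sum_le_sum_abs _ _
        _ ≤ ∑ i : Fin k, ((cM k n * (l + m * (cK k n * n)) : ℕ) : ℤ) := by
          apply Finset.sum_le_sum
          intro i _
          rw [abs_mul, Nat.cast_mul]
          apply mul_le_mul (hh i) _ (abs_nonneg _) (by positivity)
          simp only [nv, Nat.abs_cast]
          exact_mod_cast hcb i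
        _ = _ := by simp [cT])
    (fun d hd hd' => Nat.dvd_factorial hd hd') v v' hsame hmod lam' hvc
  refine ⟨fun p => if cK k n ≤ lam' p then lam2 p else lam' p, ?_⟩
  rw [h2, ← Finset.sum_filter_add_sum_filter_not P (fun p => cK k n ≤ lam' p)]
  simp only [c]
  have e1 : ∑ p ∈ P.filter (fun p => cK k n ≤ lam' p),
      (if cK k n ≤ lam' p then lam2 p else lam' p) • p = ∑ s ∈ S, lam2 s • s := by
    apply Finset.sum_congr rfl
    intro p hp
    rw [if_pos (Finset.mem_filter.1 hp).2]
  have e2 : ∑ p ∈ P.filter (fun p => ¬ cK k n ≤ lam' p),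
      (if cK k n ≤ lam' p then lam2 p else lam' p) • p =
      ∑ p ∈ P.filter (fun p => ¬ cK k n ≤ lam' p), lam' p • p := by
    apply Finset.sum_congr rfl
    intro p hp
    rw [if_neg (Finset.mem_filter.1 hp).2]
  rw [e1, e2]
  abel

lemma cs_cSame_symm {k M T : ℕ} {v v' : Fin k → ℕ} (h : cSame M T v v') : cSame M T v' v := by
  intro g hg
  rcases h g hg with h | h | h
  · exact Or.inl h.symm
  · exact Or.inr (Or.inl h.symm)
  · exact Or.inr (Or.inr h.symm)

lemma cs_assemble {k : ℕ} (X : Set (Fin k → ℕ)) (E R : ℕ)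
    (hX : ∀ v ∈ X, ∃ (r : Fin k → Fin k → ℕ) (c q : Fin k → ℕ),
      v = c + ∑ j, q j • r j ∧ (∀ j i, r j i ≤ E) ∧ (∀ i, c i ≤ R) ∧
      ∀ q' : Fin k → ℕ, c + ∑ j, q' j • r j ∈ X) :
    ∃ (J : Finset ℕ) (C' P' : ℕ → Finset (Fin k → ℕ)),
      J.card ≤ (E + 1) ^ (k * k) ∧
      (∀ j ∈ J, snorm (P' j) ≤ E ∧ snorm (C' j) ≤ R) ∧
      X = ⋃ j ∈ J, LSet (C' j) (P' j) := by
  classical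
  let F := Fin k → Fin k → Fin (E + 1)
  let e : F ≃ Fin (Fintype.card F) := Fintype.equivFin F
  have hcard : Fintype.card F = (E + 1) ^ (k * k) := by
    simp only [F]
    rw [Fintype.card_fun, Fintype.card_fun, Fintype.card_fin, Fintype.card_fin, ← pow_mul]
  let PF : F → Finset (Fin k → ℕ) := fun f => Finset.univ.image (fun j => fun i => ((f j i : Fin (E + 1)) : ℕ))
  let CF : F → Finset (Fin k → ℕ) := fun f =>
    (Fintype.piFinset (fun _ : Fin k => Finset.range (R + 1))).filter (fun c => LSet1 c (PF f) ⊆ X)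
  let P' : ℕ → Finset (Fin k → ℕ) := fun j =>
    if h : j < Fintype.card F then PF (e.symm ⟨j, h⟩) else ∅
  let C' : ℕ → Finset (Fin k → ℕ) := fun j =>
    if h : j < Fintype.card F then CF (e.symm ⟨j, h⟩) else ∅
  refine ⟨Finset.range (Fintype.card F), C', P', ?_, ?_, ?_⟩
  · rw [Finset.card_range, hcard]
  · intro j hj
    have hj := Finset.mem_range.1 hj
    simp only [P', C', dif_pos hj]
    constructor
    · apply Finset.sup_le
      intro p hp
      obtain ⟨a, -, rfl⟩ := Finset.mem_image.1 hp
      apply Finset.sup_le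
      intro i _
      exact Nat.le_of_lt_succ (Fin.is_lt _)
    · apply Finset.sup_le
      intro c hc
      have := Fintype.mem_piFinset.1 (Finset.mem_filter.1 hc).1
      apply Finset.sup_le
      intro i _
      exact Nat.le_of_lt_succ (Finset.mem_range.1 (this i))
  · ext v
    simp only [Set.mem_iUnion, Finset.mem_range, exists_prop]
    constructor
    · intro hv
      obtain ⟨r, c, q, hvc, hr, hc, hq⟩ := hX v hv
      let f : F := fun j i => ⟨r j i, Nat.lt_succ_of_le (hr j i)⟩
      have hPF : PF f = Finset.univ.image r := by
        simp only [PF, f]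
      refine ⟨e f, Fin.is_lt _, ?_⟩
      simp only [P', C', Fin.is_lt, dif_pos, Fin.eta, Equiv.symm_apply_apply]
      refine ⟨c, ?_, fun s => ∑ j, if r j = s then q j else 0, ?_⟩
      · refine Finset.mem_filter.2 ⟨?_, ?_⟩
        · rw [Fintype.mem_piFinset]
          intro i
          exact Finset.mem_range.2 (Nat.lt_succ_of_le (hc i))
        · intro y hy
          rw [mem_LSet1, hPF] at hy
          obtain ⟨lam, hy⟩ := hy
          -- choose representatives
          have hrep : ∀ s ∈ Finset.univ.image r, ∃ j, r j = s := by
            intro s hs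
            obtain ⟨j, -, h⟩ := Finset.mem_image.1 hs
            exact ⟨j, h⟩
          have := hq (fun j => ∑ s ∈ (Finset.univ.image r).attach,
            if (hrep s.1 s.2).choose = j then lam s.1 else 0)
          convert this using 1
          rw [hy]
          congr 1
          simp only [Finset.sum_smul]
          rw [Finset.sum_comm, ← Finset.sum_attach]
          apply Finset.sum_congr rfl
          intro s _
          rw [Finset.sum_eq_single (hrep s.1 s.2).choose]
          · rw [if_pos rfl, (hrep s.1 s.2).choose_spec]
          · intro j _ hj
            rw [if_neg (Ne.symm hj), zero_smul]
          · intro h; exact absurd (Finset.mem_univ _) h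
      · rw [hvc, hPF]
        congr 1
        simp only [Finset.sum_smul]
        rw [Finset.sum_comm]
        apply Finset.sum_congr rfl
        intro j _
        rw [Finset.sum_eq_single (r j)]
        · rw [if_pos rfl]
        · intro s _ hs
          rw [if_neg (Ne.symm hs), zero_smul]
        · intro h
          exact absurd (Finset.mem_image_of_mem _ (Finset.mem_univ _)) h
    · rintro ⟨j, hj, c, hc, lam, hv⟩
      simp only [P', C', dif_pos hj] at hc hv
      apply (Finset.mem_filter.1 hc).2
      rw [mem_LSet1]
      exact ⟨lam, hv⟩

lemma cs_main {ι : Type*} (k : ℕ) (hk : 1 ≤ k) (I : Finset ι)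
    (x : ι → (Fin k → ℕ)) (P : ι → Finset (Fin k → ℕ)) (n m l : ℕ)
    (hn : ∀ i ∈ I, ∀ s ∈ P i, ∀ a, s a ≤ n) (hm : ∀ i ∈ I, (P i).card ≤ m)
    (hl : ∀ i ∈ I, ∀ a, x i a ≤ l) :
    ∃ (J : Finset ℕ) (C' P' : ℕ → Finset (Fin k → ℕ)),
      J.card ≤ ((cM k n).factorial * cB k (cM k n) + 1) ^ (k * k) ∧
      (∀ j ∈ J, snorm (P' j) ≤ (cM k n).factorial * cB k (cM k n) ∧
        snorm (C' j) ≤ cB k (cM k n) * (cT k n m l + 1) +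
          k * ((cM k n).factorial * cB k (cM k n))) ∧
      (⋃ i ∈ I, LSet1 (x i) (P i))ᶜ = ⋃ j ∈ J, LSet (C' j) (P' j) := by
  apply cs_assemble
  intro v hv
  obtain ⟨r, c, q, hvc, hr, hc, hq⟩ := cs_pump (cM k n) (cM_pos k n) (cT k n m l)
    (cM k n).factorial (Nat.factorial_pos _) v
  refine ⟨fun j => (cM k n).factorial • r j, c, q, hvc, ?_, hc, ?_⟩
  · intro j i
    simp only [Pi.smul_apply, smul_eq_mul]
    exact Nat.mul_le_mul_left _ (hr j i)
  · intro q' hmem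
    apply hv
    simp only [Set.mem_iUnion] at hmem ⊢
    obtain ⟨i, hi, hmem⟩ := hmem
    refine ⟨i, hi, ?_⟩
    apply cs_transfer hk n m l (x i) (hl i hi) (P i) (hn i hi) (hm i hi) _ v
      (cs_cSame_symm (hq q')) _ hmem
    intro a
    have h1 : nv v a - nv (c + ∑ j, q' j • (cM k n).factorial • r j) a =
        ((cM k n).factorial : ℤ) * ∑ j, ((q j : ℤ) - q' j) * r j a := by
      conv_lhs => rw [hvc]
      simp only [nv, Pi.add_apply, Finset.sum_apply, Pi.smul_apply, smul_eq_mul]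
      push_cast
      rw [Finset.mul_sum, add_sub_add_left_eq_sub, ← Finset.sum_sub_distrib]
      apply Finset.sum_congr rfl
      intro j _
      ring
    rw [h1]
    exact Dvd.intro _ rfl

lemma cs_two_pow (a : ℕ) : a ≤ 2 ^ a := Nat.lt_two_pow_self.le

lemma cM_le_pow (k n : ℕ) : cM k n ≤ 2 ^ (k * (k + n + 1)) := by
  unfold cM
  calc k.factorial * (n + 1) ^ k ≤ k ^ k * (n + 1) ^ k :=
        Nat.mul_le_mul_right _ (Nat.factorial_le_pow k)
    _ ≤ (2 ^ k) ^ k * (2 ^ (n + 1)) ^ k := by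
        gcongr
        · exact cs_two_pow k
        · exact cs_two_pow (n + 1)
    _ = _ := by rw [← pow_mul, ← pow_mul, ← pow_add]; congr 1; ring

lemma cB_le_pow (k n : ℕ) : cB k (cM k n) ≤ 2 ^ (k + k * k + k * (k + n + 1) * k) := by
  unfold cB
  calc k * (k.factorial * cM k n ^ k) ≤ 2 ^ k * ((2 ^ k) ^ k * (2 ^ (k * (k + n + 1))) ^ k) := by
        gcongr
        · exact cs_two_pow k
        · exact (Nat.factorial_le_pow k).trans (Nat.pow_le_pow_left (cs_two_pow k) k)
        · exact cM_le_pow k n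
    _ = _ := by rw [← pow_mul, ← pow_mul, ← pow_add, ← pow_add]; congr 1; ring

lemma cD_le_pow (k n : ℕ) : (cM k n).factorial ≤ 2 ^ (k * (k + n + 1) * cM k n) := by
  calc (cM k n).factorial ≤ cM k n ^ cM k n := Nat.factorial_le_pow _
    _ ≤ (2 ^ (k * (k + n + 1))) ^ cM k n := Nat.pow_le_pow_left (cM_le_pow k n) _
    _ = _ := by rw [← pow_mul]

/-- natural lower bound for the exponent -/
def cBeta (k n : ℕ) : ℕ := cM k n * ((n + 2) * (3 * k + 2) ^ 6)

lemma cs_e_le (k n : ℕ) (hk : 1 ≤ k) : k * (k + n + 1) ≤ k ^ 2 * (n + 2) := by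
  obtain ⟨j, rfl⟩ := Nat.exists_eq_add_of_le hk
  nlinarith [Nat.zero_le (j * n), Nat.zero_le (j * j * n), Nat.zero_le (j * j)]

lemma cs_six (k : ℕ) (hk : 1 ≤ k) : 14 * k ^ 5 ≤ (3 * k + 2) ^ 6 := by
  calc 14 * k ^ 5 ≤ 14 * k ^ 6 := by gcongr; omega
    _ ≤ 729 * k ^ 6 := by omega
    _ = (3 * k) ^ 6 := by ring
    _ ≤ _ := by gcongr; omega

lemma cs_N1 (k n : ℕ) (hk : 1 ≤ k) :
    ((cM k n).factorial * cB k (cM k n) + 1) ^ (k * k) ≤ 2 ^ cBeta k n := by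
  have hM := cM_pos k n
  have hD := cD_le_pow k n
  have hB := cB_le_pow k n
  have he := cs_e_le k n hk
  set M := cM k n with hMdef
  set e := k * (k + n + 1) with hedef
  have h1 : M.factorial * cB k M + 1 ≤ 2 ^ (e * M + (k + k * k + e * k) + 1) := by
    have h2 : M.factorial * cB k M ≤ 2 ^ (e * M) * 2 ^ (k + k * k + e * k) :=
      Nat.mul_le_mul hD hB
    rw [← pow_add] at h2
    have h3 : 1 ≤ 2 ^ (e * M + (k + k * k + e * k)) := Nat.one_le_two_pow
    rw [pow_succ]
    omega
  refine (Nat.pow_le_pow_left h1 _).trans ?_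
  rw [← pow_mul]
  apply Nat.pow_le_pow_right (by norm_num)
  unfold cBeta
  rw [← hMdef]
  have hk2 : k ≤ k ^ 3 := Nat.le_self_pow (by norm_num) k
  have hk3 : k ^ 2 ≤ k ^ 3 := Nat.pow_le_pow_right hk (by norm_num)
  have hk4 : 1 ≤ k ^ 3 := Nat.one_le_pow _ _ hk
  have hn : 1 ≤ n + 2 := by omega
  calc (e * M + (k + k * k + e * k) + 1) * (k * k)
      ≤ (M * (5 * k ^ 3 * (n + 2))) * (k * k) := by
        apply Nat.mul_le_mul_right
        have a1 : e * M ≤ M * (k ^ 3 * (n + 2)) := by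
          rw [mul_comm]; exact Nat.mul_le_mul_left _ (he.trans (Nat.mul_le_mul_right _ hk3))
        have a2 : k ≤ M * (k ^ 3 * (n + 2)) := by
          calc k = 1 * (k * 1) := by ring
            _ ≤ _ := by gcongr
        have a3 : k * k ≤ M * (k ^ 3 * (n + 2)) := by
          calc k * k = 1 * (k ^ 2 * 1) := by ring
            _ ≤ _ := by gcongr
        have a4 : e * k ≤ M * (k ^ 3 * (n + 2)) := by
          calc e * k ≤ (k ^ 2 * (n + 2)) * k := by gcongr
            _ = 1 * (k ^ 3 * (n + 2)) := by ring
            _ ≤ _ := by gcongr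
        have a5 : 1 ≤ M * (k ^ 3 * (n + 2)) := by
          calc 1 = 1 * (1 * 1) := by ring
            _ ≤ _ := by gcongr
        have : M * (5 * k ^ 3 * (n + 2)) = 5 * (M * (k ^ 3 * (n + 2))) := by ring
        omega
    _ = M * ((n + 2) * (5 * k ^ 5)) := by ring
    _ ≤ _ := by
        gcongr
        have := cs_six k hk
        omega

lemma cs_N3 (k n m l : ℕ) (hk : 1 ≤ k) (hm : m ≤ (n + 1) ^ k) :
    cB k (cM k n) * (cT k n m l + 1) + k * ((cM k n).factorial * cB k (cM k n)) ≤
      2 ^ cBeta k n * (l + 1) := by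
  have hM := cM_pos k n
  have hD := cD_le_pow k n
  have hB := cB_le_pow k n
  have he := cs_e_le k n hk
  have hMe := cM_le_pow k n
  have hD1 : 1 ≤ (cM k n).factorial := Nat.factorial_pos _
  have hnM : (n + 1) ^ k ≤ cM k n := Nat.le_mul_of_pos_left _ (Nat.factorial_pos _)
  have hnM1 : n + 1 ≤ cM k n := (Nat.le_self_pow (by omega) _).trans hnM
  have hmM := hm.trans hnM
  have hT : cT k n m l + 1 ≤ 3 * k ^ 3 * cM k n ^ 5 * (l + 1) := by
    unfold cT cK
    set M := cM k n
    have h1 : m * (k * (k * (M * (n + 1))) * n) ≤ k ^ 2 * M ^ 4 := by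
      calc m * (k * (k * (M * (n + 1))) * n) ≤ M * (k * (k * (M * M)) * M) := by
            gcongr
            omega
        _ = _ := by ring
    have b1 : k * (M * l) ≤ (k ^ 3 * M ^ 5) * l := by
      rw [← mul_assoc]
      gcongr
      · exact Nat.le_self_pow (by norm_num) k
      · exact Nat.le_self_pow (by norm_num) M
    have b2 : 1 ≤ k ^ 3 * M ^ 5 := Nat.mul_pos (by positivity) (by positivity)
    calc k * (M * (l + m * (k * (k * (M * (n + 1))) * n))) + 1
        ≤ k * (M * (l + k ^ 2 * M ^ 4)) + 1 := by gcongr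
      _ = k * (M * l) + k ^ 3 * M ^ 5 + 1 := by ring
      _ ≤ (k ^ 3 * M ^ 5) * l + k ^ 3 * M ^ 5 + k ^ 3 * M ^ 5 := by omega
      _ ≤ _ := by nlinarith [Nat.zero_le ((k ^ 3 * M ^ 5) * l)]
  unfold cBeta
  set M := cM k n with hMdef
  set e := k * (k + n + 1) with hedef
  set B := cB k M
  set D := M.factorial
  have hk1 : k ≤ k ^ 3 := Nat.le_self_pow (by norm_num) k
  have hk3 : k ^ 2 ≤ k ^ 3 := Nat.pow_le_pow_right hk (by norm_num)
  have hk4 : 1 ≤ k ^ 3 := Nat.one_le_pow _ _ hk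
  have hn : 1 ≤ n + 2 := by omega
  have hl : 1 ≤ l + 1 := by omega
  have hM5 : 1 ≤ M ^ 5 := Nat.one_le_pow _ _ hM
  calc B * (cT k n m l + 1) + k * (D * B)
      ≤ B * (3 * k ^ 3 * M ^ 5 * (l + 1)) + k * (D * B) := by gcongr
    _ = B * (3 * k ^ 3 * M ^ 5 * (l + 1)) * 1 + k * (D * B) * (1 * 1) := by ring
    _ ≤ B * (3 * k ^ 3 * M ^ 5 * (l + 1)) * D + k ^ 3 * (D * B) * (M ^ 5 * (l + 1)) := by gcongr
    _ = B * (2 ^ 2 * k ^ 3 * M ^ 5 * D) * (l + 1) := by ring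
    _ ≤ 2 ^ (k + k * k + e * k) * (2 ^ 2 * (2 ^ k) ^ 3 * (2 ^ e) ^ 5 * 2 ^ (e * M)) * (l + 1) := by
        gcongr
        exact cs_two_pow k
    _ = 2 ^ ((k + k * k + e * k) + (2 + k * 3 + e * 5 + e * M)) * (l + 1) := by
        simp only [← pow_mul, ← pow_add]
    _ ≤ _ := by
        apply Nat.mul_le_mul_right
        apply Nat.pow_le_pow_right (by norm_num)
        set Q := M * (k ^ 3 * (n + 2)) with hQ
        have a0 : e * M ≤ Q := by
          rw [mul_comm]; exact Nat.mul_le_mul_left _ (he.trans (Nat.mul_le_mul_right _ hk3))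
        have a1 : e ≤ Q := (Nat.le_mul_of_pos_right e hM).trans a0
        have a2 : k ≤ Q := by
          calc k = 1 * (k * 1) := by ring
            _ ≤ _ := by rw [hQ]; gcongr
        have a3 : k * k ≤ Q := by
          calc k * k = 1 * (k ^ 2 * 1) := by ring
            _ ≤ _ := by rw [hQ]; gcongr
        have a4 : e * k ≤ Q := by
          calc e * k ≤ (k ^ 2 * (n + 2)) * k := by gcongr
            _ = 1 * (k ^ 3 * (n + 2)) := by ring
            _ ≤ _ := by rw [hQ]; gcongr
        have a5 : 1 ≤ Q := by
          calc 1 = 1 * (1 * 1) := by ring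
            _ ≤ _ := by rw [hQ]; gcongr
        have h14 : 14 * Q ≤ M * ((n + 2) * (3 * k + 2) ^ 6) := by
          calc 14 * Q = M * ((n + 2) * (14 * k ^ 3)) := by rw [hQ]; ring
            _ ≤ M * ((n + 2) * (14 * k ^ 5)) := by
              gcongr
              norm_num
            _ ≤ _ := by gcongr; exact cs_six k hk
        omega

lemma cs_real (k n m i : ℕ) (hk : 1 ≤ k) (hm : m ≤ (n + 1) ^ k) (hi : 1 ≤ i) :
    (cBeta k n : ℝ) ≤ (Real.sqrt k * ((n : ℝ) + 2)) ^
        ((k : ℝ) * Real.logb 2 (3 * (k : ℝ) + 2) * (3 * (m : ℝ) + 1) + 3) *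
      (3 * (k : ℝ) + 2) ^ (-(2 * Real.logb 2 (Real.exp 1) + 1) * (m : ℝ) + 7) *
      (i : ℝ) ^ Real.logb 2 (3 * (k : ℝ) + 2) := by
  have hkR : (1 : ℝ) ≤ k := by exact_mod_cast hk
  have hsq : 1 ≤ Real.sqrt k := by rw [Real.one_le_sqrt]; exact hkR
  have hnR : (0 : ℝ) ≤ n := Nat.cast_nonneg _
  set N : ℝ := Real.sqrt k * ((n : ℝ) + 2) with hN
  have hNn : (n : ℝ) + 2 ≤ N := by
    rw [hN]; exact le_mul_of_one_le_left (by positivity) hsq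
  have hN2 : 2 ≤ N := by linarith
  have hN0 : 0 < N := by linarith
  have hN1 : 1 ≤ N := by linarith
  set u : ℝ := 3 * (k : ℝ) + 2 with hu
  have hu5 : 5 ≤ u := by rw [hu]; linarith
  have hu0 : 0 < u := by linarith
  have hu1 : 1 ≤ u := by linarith
  set L : ℝ := Real.logb 2 u with hL
  have h2L : (2 : ℝ) ^ L = u := Real.rpow_logb (by norm_num) (by norm_num) hu0
  have hL2 : 2 ≤ L := by
    rw [hL, Real.le_logb_iff_rpow_le (by norm_num) hu0]
    norm_num; linarith
  have hL0 : 0 ≤ L := by linarith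
  have hmR : (0 : ℝ) ≤ m := Nat.cast_nonneg _
  have hlog : Real.logb 2 (Real.exp 1) ≤ 3 / 2 := by
    rw [Real.logb, Real.log_exp, div_le_iff₀ (Real.log_pos (by norm_num))]
    have := Real.log_two_gt_d9
    linarith
  have hI : (1 : ℝ) ≤ (i : ℝ) ^ L := Real.one_le_rpow (by exact_mod_cast hi) hL0
  have hu7 : u ^ (7 - 4 * (m : ℝ)) ≤ u ^ (-(2 * Real.logb 2 (Real.exp 1) + 1) * (m : ℝ) + 7) := by
    apply Real.rpow_le_rpow_of_exponent_le hu1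
    nlinarith
  have hsplit : N ^ ((k : ℝ) * L * (3 * (m : ℝ) + 1) + 3) =
      N ^ (3 * (k : ℝ) * (L * m)) * N ^ ((k : ℝ) * L) * N ^ (3 : ℝ) := by
    rw [← Real.rpow_add hN0, ← Real.rpow_add hN0]; congr 1; ring
  have hc3 : (n : ℝ) + 2 ≤ N ^ (3 : ℝ) := by
    refine hNn.trans ?_
    conv_lhs => rw [← Real.rpow_one N]
    exact Real.rpow_le_rpow_of_exponent_le hN1 (by norm_num)
  have hcM : (cM k n : ℝ) ≤ N ^ ((k : ℝ) * L) := by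
    have h1 : (cM k n : ℝ) ≤ ((k : ℝ) * ((n : ℝ) + 1)) ^ k := by
      have : cM k n ≤ (k * (n + 1)) ^ k := by
        unfold cM; rw [mul_pow]
        exact Nat.mul_le_mul_right _ (Nat.factorial_le_pow k)
      exact_mod_cast this
    have h2 : (k : ℝ) * ((n : ℝ) + 1) ≤ N ^ 2 := by
      rw [hN, mul_pow, Real.sq_sqrt (by positivity)]
      gcongr
      nlinarith
    calc (cM k n : ℝ) ≤ ((k : ℝ) * ((n : ℝ) + 1)) ^ k := h1
      _ ≤ (N ^ 2) ^ k := by gcongr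
      _ = N ^ ((k : ℝ) * 2) := by
        rw [← pow_mul, ← Real.rpow_natCast]; congr 1; push_cast; ring
      _ ≤ _ := by
        apply Real.rpow_le_rpow_of_exponent_le hN1
        gcongr
  have hmain : u ^ (4 * (m : ℝ) - 1) ≤ N ^ (3 * (k : ℝ) * (L * m)) := by
    have hLm : 0 ≤ L * m := by positivity
    by_cases hdeg : k = 1 ∧ n = 0
    · obtain ⟨rfl, rfl⟩ := hdeg
      have hm1 : (m : ℝ) ≤ 1 := by
        have : m ≤ 1 := by simpa using hm
        exact_mod_cast this
      calc u ^ (4 * (m : ℝ) - 1) ≤ u ^ (3 * (m : ℝ)) :=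
            Real.rpow_le_rpow_of_exponent_le hu1 (by linarith)
        _ = (2 : ℝ) ^ (3 * ((1 : ℕ) : ℝ) * (L * m)) := by
            rw [← h2L, ← Real.rpow_mul (by norm_num)]; congr 1; push_cast; ring
        _ ≤ _ := Real.rpow_le_rpow (by norm_num) hN2 (by positivity)
    · have h16 : (2 : ℝ) ^ (4 : ℝ) ≤ N ^ (3 * (k : ℝ)) := by
        by_cases hk2 : 2 ≤ k
        · have hk2R : (2 : ℝ) ≤ k := by exact_mod_cast hk2
          calc (2 : ℝ) ^ (4 : ℝ) ≤ 2 ^ (3 * (k : ℝ)) :=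
                Real.rpow_le_rpow_of_exponent_le (by norm_num) (by linarith)
            _ ≤ _ := Real.rpow_le_rpow (by norm_num) hN2 (by positivity)
        · have hk1 : k = 1 := by omega
          have hn1 : 1 ≤ n := by
            by_contra h
            exact hdeg ⟨hk1, by omega⟩
          have hn1R : (1 : ℝ) ≤ n := by exact_mod_cast hn1
          have hN3 : 3 ≤ N := by linarith
          calc (2 : ℝ) ^ (4 : ℝ) ≤ (3 : ℝ) ^ (3 : ℝ) := by norm_num
            _ ≤ (3 : ℝ) ^ (3 * (k : ℝ)) :=
                Real.rpow_le_rpow_of_exponent_le (by norm_num) (by linarith)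
            _ ≤ _ := Real.rpow_le_rpow (by norm_num) hN3 (by positivity)
      calc u ^ (4 * (m : ℝ) - 1) ≤ u ^ (4 * (m : ℝ)) :=
            Real.rpow_le_rpow_of_exponent_le hu1 (by linarith)
        _ = ((2 : ℝ) ^ (4 : ℝ)) ^ (L * m) := by
            rw [← h2L, ← Real.rpow_mul (by norm_num), ← Real.rpow_mul (by norm_num)]
            congr 1; ring
        _ ≤ (N ^ (3 * (k : ℝ))) ^ (L * m) := Real.rpow_le_rpow (by positivity) h16 hLm
        _ = _ := by rw [← Real.rpow_mul hN0.le]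
  have h6 : u ^ 6 = u ^ (4 * (m : ℝ) - 1) * u ^ (7 - 4 * (m : ℝ)) := by
    rw [← Real.rpow_add hu0, ← Real.rpow_natCast]
    congr 1
    push_cast; ring
  calc (cBeta k n : ℝ) = u ^ 6 * cM k n * ((n : ℝ) + 2) := by
        unfold cBeta; push_cast; rw [hu]; ring
    _ = u ^ (4 * (m : ℝ) - 1) * cM k n * ((n : ℝ) + 2) * u ^ (7 - 4 * (m : ℝ)) := by
        rw [h6]; ring
    _ ≤ N ^ (3 * (k : ℝ) * (L * m)) * N ^ ((k : ℝ) * L) * N ^ (3 : ℝ) *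
        u ^ (-(2 * Real.logb 2 (Real.exp 1) + 1) * (m : ℝ) + 7) := by gcongr
    _ ≤ _ := by
        rw [hsplit]
        exact le_mul_of_one_le_right (by positivity) hI

/-- Complement of an arbitrary semilinear set, with the bound
`b(k,n,m,I) = (√k (n+2))^(k log₂(3k+2)(3m+1)+3) · (3k+2)^(−(2log₂ e+1)m+7) · |I|^(log₂(3k+2))`. -/
theorem compl_semilinear {ι : Type*} (k : ℕ) (hk : 1 ≤ k)
    (I : Finset ι) (hI : I.Nonempty)
    (x : ι → (Fin k → ℕ)) (P : ι → Finset (Fin k → ℕ))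
    (n m ℓ : ℕ) (b : ℝ)
    (hn : n = I.sup fun i => snorm (P i))
    (hm : m = I.sup fun i => (P i).card)
    (hℓ : ℓ = I.sup fun i => vnorm (x i))
    (hb : b = (Real.sqrt k * ((n : ℝ) + 2)) ^
        ((k : ℝ) * Real.logb 2 (3 * (k : ℝ) + 2) * (3 * (m : ℝ) + 1) + 3) *
      (3 * (k : ℝ) + 2) ^ (-(2 * Real.logb 2 (Real.exp 1) + 1) * (m : ℝ) + 7) *
      (I.card : ℝ) ^ Real.logb 2 (3 * (k : ℝ) + 2)) :
    ∃ (J : Finset ℕ) (C' P' : ℕ → Finset (Fin k → ℕ)),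
      (J.card : ℝ) ≤ (2 : ℝ) ^ b * ((ℓ : ℝ) + 2) ^
        ((Real.sqrt k * ((n : ℝ) + 2)) ^ ((k : ℝ) * (3 * (m : ℝ) + 1) + 8) *
          (2 * Real.exp 1 ^ 2) ^ (-(m : ℝ)) * (I.card : ℝ)) ∧
      (∀ j ∈ J,
        (snorm (P' j) : ℝ) ≤ (2 : ℝ) ^ b ∧
        (snorm (C' j) : ℝ) ≤ (2 : ℝ) ^ b * ((ℓ : ℝ) + 1)) ∧
      (⋃ i ∈ I, LSet1 (x i) (P i))ᶜ = ⋃ j ∈ J, LSet (C' j) (P' j) := by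
  have hnb : ∀ i ∈ I, ∀ s ∈ P i, ∀ a, s a ≤ n := by
    intro i hi s hs a
    rw [hn]
    calc s a ≤ vnorm s := Finset.le_sup (f := s) (Finset.mem_univ a)
      _ ≤ snorm (P i) := Finset.le_sup (f := vnorm) hs
      _ ≤ _ := Finset.le_sup (f := fun i => snorm (P i)) hi
  have hmb : ∀ i ∈ I, (P i).card ≤ m := by
    intro i hi
    rw [hm]
    exact Finset.le_sup (f := fun i => (P i).card) hi
  have hlb : ∀ i ∈ I, ∀ a, x i a ≤ ℓ := by
    intro i hi a
    rw [hℓ]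
    calc x i a ≤ vnorm (x i) := Finset.le_sup (f := x i) (Finset.mem_univ a)
      _ ≤ _ := Finset.le_sup (f := fun i => vnorm (x i)) hi
  have hmn : m ≤ (n + 1) ^ k := by
    rw [hm]
    apply Finset.sup_le
    intro i hi
    have hsub : P i ⊆ Fintype.piFinset (fun _ : Fin k => Finset.range (n + 1)) := by
      intro s hs
      rw [Fintype.mem_piFinset]
      intro a
      exact Finset.mem_range.2 (Nat.lt_succ_of_le (hnb i hi s hs a))
    have := Finset.card_le_card hsub
    simpa using this
  have hbeta : (cBeta k n : ℝ) ≤ b := by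
    rw [hb]
    exact cs_real k n m I.card hk hmn (Finset.card_pos.2 hI)
  have h2b : ((2 ^ cBeta k n : ℕ) : ℝ) ≤ (2 : ℝ) ^ b := by
    push_cast
    rw [← Real.rpow_natCast]
    exact Real.rpow_le_rpow_of_exponent_le (by norm_num) hbeta
  obtain ⟨J, C', P', hJ, hbd, hU⟩ := cs_main k hk I x P n m ℓ hnb hmb hlb
  refine ⟨J, C', P', ?_, ?_, hU⟩
  · have h1 : (J.card : ℝ) ≤ ((2 ^ cBeta k n : ℕ) : ℝ) := by
      exact_mod_cast hJ.trans (cs_N1 k n hk)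
    refine (h1.trans h2b).trans ?_
    apply le_mul_of_one_le_right (by positivity)
    apply Real.one_le_rpow
    · have : (0 : ℝ) ≤ ℓ := Nat.cast_nonneg _
      linarith
    · positivity
  · intro j hj
    obtain ⟨h1, h2⟩ := hbd j hj
    constructor
    · refine le_trans ?_ h2b
      have h3 : snorm (P' j) ≤ 2 ^ cBeta k n := by
        refine h1.trans (le_trans ?_ (cs_N1 k n hk))
        refine le_trans (Nat.le_succ _) ?_
        exact Nat.le_self_pow (by positivity) _
      exact_mod_cast h3
    · have h3 := h2.trans (cs_N3 k n m ℓ hk hmn)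
      have h4 : (snorm (C' j) : ℝ) ≤ ((2 ^ cBeta k n : ℕ) : ℝ) * ((ℓ : ℝ) + 1) := by
        exact_mod_cast h3
      refine h4.trans ?_
      gcongr
end

section
/- Let k₁, k₂ ≥ 1 and let ⋃_{i ∈ I} L(c_i, P_i) be a semilinear subset of ℕ^{k₂}. Set n = max_{i ∈ I} ‖P_i‖, m = max_{i ∈ I} |P_i|, and ℓ = max_{i ∈ I} ‖c_i‖. Let H ∈ ℕ^{k₂ × k₁} be a matrix and h : ℕ^{k₁} → ℕ^{k₂} the linear function x ↦ H x. Then for every i ∈ I there exist finite sets Q_i, C_i ⊆ ℕ^{k₁} with ‖Q_i‖ ≤ (k₁ + m + 1) · k₂^{min(k₁+m, k₂)/2} · (‖H‖+1)^{min(k₁,k₂)} · (n+1)^{min(m,k₂)} and ‖C_i‖ ≤ (k₁ + m + 1) · k₂^{min(k₁+m, k₂)/2} · (‖H‖+1)^{min(k₁,k₂)} · (n+1)^{min(m,k₂)} · ℓ, such that h^{-1}(⋃_{i ∈ I} L(c_i, P_i)) = ⋃_{i ∈ I} L(C_i, Q_i). -/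
open Matrix in
theorem hadamard_fin {r : ℕ} (M : Matrix (Fin r) (Fin r) ℝ) (w : Fin r → ℝ)
    (hw : ∀ i j, |M i j| ≤ w j) :
    |M.det| ≤ (Real.sqrt r) ^ r * ∏ j, w j := by
  have : Fact (Module.finrank ℝ (EuclideanSpace ℝ (Fin r)) = r) := ⟨by simp⟩
  let b := EuclideanSpace.basisFun (Fin r) ℝ
  let o := b.toBasis.orientation
  let v : Fin r → EuclideanSpace ℝ (Fin r) := fun j => WithLp.toLp 2 (fun i => M i j)
  have h1 : |o.volumeForm v| ≤ ∏ i, ‖v i‖ := o.abs_volumeForm_apply_le v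
  rw [o.volumeForm_robust' b] at h1
  have h2 : b.toBasis.det v = M.det := by
    rw [Module.Basis.det_apply]
    congr 1
  rw [h2] at h1
  have h3 : ∀ j, ‖v j‖ ≤ Real.sqrt r * w j := by
    intro j
    have hwj : 0 ≤ w j := (abs_nonneg _).trans (hw j j)
    rw [EuclideanSpace.norm_eq]
    calc Real.sqrt (∑ i, ‖v j i‖ ^ 2) ≤ Real.sqrt (∑ i : Fin r, w j ^ 2) := by
          apply Real.sqrt_le_sqrt
          apply Finset.sum_le_sum
          intro i _
          have := hw i j
          simp only [v, Real.norm_eq_abs]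
          gcongr
      _ = Real.sqrt r * w j := by
          simp [Real.sqrt_sq hwj]
  calc |M.det| ≤ ∏ i, ‖v i‖ := h1
    _ ≤ ∏ i, (Real.sqrt r * w i) := Finset.prod_le_prod (fun _ _ => norm_nonneg _) (fun j _ => h3 j)
    _ = _ := by simp [Finset.prod_mul_distrib]

theorem hadamard_gen {T : Type*} [Fintype T] [DecidableEq T] (M : Matrix T T ℝ) (w : T → ℝ)
    (hw : ∀ i j, |M i j| ≤ w j) :
    |M.det| ≤ (Real.sqrt (Fintype.card T)) ^ (Fintype.card T) * ∏ j, w j := by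
  let e := Fintype.equivFin T
  have := hadamard_fin (M.submatrix e.symm e.symm) (w ∘ e.symm) (fun i j => hw _ _)
  rw [Matrix.det_submatrix_equiv_self] at this
  rwa [← Equiv.prod_comp e.symm w]

/-- A matrix with injective `mulVec` has a nonsingular square submatrix using all columns. -/
theorem exists_rows {k : ℕ} {T : Type} [Fintype T] [DecidableEq T] (M : Matrix (Fin k) T ℝ)
    (hM : ∀ x, M.mulVec x = 0 → x = 0) :
    ∃ f : T → Fin k, Function.Injective f ∧ (M.submatrix f id).det ≠ 0 := by
  have hinj : Function.Injective M.mulVecLin := by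
    rw [← LinearMap.ker_eq_bot, LinearMap.ker_eq_bot']
    intro x hx
    exact hM x (by simpa using hx)
  have hrank : M.rank = Fintype.card T := by
    rw [Matrix.rank, LinearMap.finrank_range_of_inj hinj]
    simp
  obtain ⟨κ, a, ha, hsp, hli⟩ := exists_linearIndependent' ℝ M.row
  have : Finite κ := Finite.of_injective a ha
  have := Fintype.ofFinite κ
  have hc : Fintype.card κ = Fintype.card T := by
    rw [← hrank, Matrix.rank_eq_finrank_span_row, ← hsp, finrank_span_eq_card hli]
  let e : T ≃ κ := (Fintype.equivOfCardEq hc).symm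
  refine ⟨a ∘ e, ha.comp e.injective, ?_⟩
  have : LinearIndependent ℝ (M.submatrix (a ∘ e) id).row := by
    have := hli.comp e e.injective
    exact this
  rw [Matrix.linearIndependent_rows_iff_isUnit, Matrix.isUnit_iff_isUnit_det] at this
  exact this.ne_zero
  
theorem cramer_real {T : Type} [Fintype T] [DecidableEq T] (M : Matrix T T ℝ) (x : T → ℝ) (t : T) :
    M.det * x t = (M.updateCol t (M.mulVec x)).det := by
  rw [← Matrix.cramer_apply, Matrix.cramer_eq_adjugate_mulVec, Matrix.mulVec_mulVec,
    Matrix.adjugate_mul, Matrix.smul_mulVec, Matrix.one_mulVec]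
  simp

/-- Cramer bound. -/
theorem cramer_main {k : ℕ} {J : Type} [Fintype J] [DecidableEq J] (A : Matrix (Fin k) J ℤ)
    (T : Finset J)
    (hT : ∀ x : J → ℝ, (∀ j, j ∉ T → x j = 0) → (A.map (Int.cast : ℤ → ℝ)).mulVec x = 0 → x = 0) :
    ∃ f : T → Fin k, Function.Injective f ∧ 
      (A.submatrix f (Subtype.val : T → J)).det ≠ 0 ∧
      ∀ x : J → ℝ, (∀ j, j ∉ T → x j = 0) → ∀ t : T,
        ((A.submatrix f (Subtype.val : T → J)).det : ℝ) * x t = 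
        (((A.submatrix f (Subtype.val : T → J)).map (Int.cast : ℤ → ℝ)).updateCol t
          (fun s => (A.map (Int.cast : ℤ → ℝ)).mulVec x (f s))).det := by
  set AR := A.map (Int.cast : ℤ → ℝ) with hAR
  have key : ∀ x : J → ℝ, (∀ j, j ∉ T → x j = 0) →
      (AR.submatrix id (Subtype.val : T → J)).mulVec (fun t => x t) = AR.mulVec x := by
    intro x hx
    ext i
    simp only [Matrix.mulVec, dotProduct, Matrix.submatrix_apply, id]
    rw [Finset.sum_coe_sort T (fun j => AR i j * x j)]
    apply Finset.sum_subset (Finset.subset_univ _)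
    intro j _ hj
    simp [hx j hj]
  obtain ⟨f, hf, hdet⟩ := exists_rows (AR.submatrix id (Subtype.val : T → J)) (by
    intro x hx
    let x' : J → ℝ := fun j => if h : j ∈ T then x ⟨j, h⟩ else 0
    have hx' : ∀ j, j ∉ T → x' j = 0 := fun j hj => by simp [x', hj]
    have hxx : (fun t : T => x' t) = x := by ext t; simp [x']
    have h0 := hT x' hx' (by rw [← key x' hx', hxx, hx])
    rw [← hxx, h0]; rfl)
  have hdd : ((A.submatrix f (Subtype.val : T → J)).det : ℝ) =
      ((A.submatrix f (Subtype.val : T → J)).map (Int.cast : ℤ → ℝ)).det := by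
    have := (Int.castRingHom ℝ).map_det (A.submatrix f (Subtype.val : T → J))
    simpa using this
  refine ⟨f, hf, ?_, ?_⟩
  · intro h0
    apply hdet
    have : ((A.submatrix f (Subtype.val : T → J)).det : ℝ) = 0 := by rw [h0]; simp
    rw [hdd] at this
    exact this
  · intro x hx t
    rw [hdd, cramer_real _ (fun t : T => x t) t]
    congr 2
    have := key x hx
    ext s
    rw [← this]
    rfl

theorem det_bound {k : ℕ} {J : Type} [Fintype J] [DecidableEq J] (A : Matrix (Fin k) J ℤ)
    (w : J → ℝ) (hw0 : ∀ j, 0 ≤ w j) (hw : ∀ i j, |(A i j : ℝ)| ≤ w j)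
    (T : Finset J) (hk : T.card ≤ k) (f : T → Fin k) (t : T) (v : T → ℝ) (L : ℝ)
    (hL : 0 ≤ L) (hv : ∀ s, |v s| ≤ L) :
    |(((A.submatrix f (Subtype.val : T → J)).map (Int.cast : ℤ → ℝ)).updateCol t v).det| ≤
      (Real.sqrt k) ^ T.card * (L * ∏ j ∈ T.erase t, w j) := by
  have h1 := hadamard_gen (((A.submatrix f (Subtype.val : T → J)).map
    (Int.cast : ℤ → ℝ)).updateCol t v) (Function.update (fun s : T => w s) t L) (by
      intro i j
      by_cases hj : j = t
      · subst hj; simpa using hv i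
      · simpa [Matrix.updateCol_ne hj, hj] using hw (f i) j)
  have h2 : ∏ j, (Function.update (fun s : T => w s) t L) j = L * ∏ j ∈ T.erase t, w j := by
    rw [Finset.prod_update_of_mem (Finset.mem_univ t)]
    congr 1
    rw [← Finset.erase_eq, ← Finset.prod_image (s := Finset.univ.erase t) (g := Subtype.val)
      (f := w) (by intro a _ b _ h; exact Subtype.ext h)]
    congr 1
    ext j
    simp only [Finset.mem_image, Finset.mem_erase, Finset.mem_univ, and_true]
    constructor
    · rintro ⟨a, ha, rfl⟩
      exact ⟨fun h => ha (Subtype.ext h), a.2⟩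
    · rintro ⟨h, h'⟩
      exact ⟨⟨j, h'⟩, fun hh => h (by rw [← hh]), rfl⟩
  rw [h2, Fintype.card_coe] at h1
  refine h1.trans ?_
  have : 0 ≤ ∏ j ∈ T.erase t, w j := Finset.prod_nonneg (fun j _ => hw0 j)
  gcongr

/-- The ratio test. -/
theorem ratio_test {J : Type} [Fintype J] (y z : J → ℝ) (hy : ∀ j, 0 ≤ y j)
    (hs : ∀ j, y j = 0 → z j = 0) (hz : ∃ j, 0 < z j) :
    ∃ t : ℝ, 0 < t ∧ (∀ j, 0 ≤ y j - t * z j) ∧ ∃ j, 0 < z j ∧ y j - t * z j = 0 := by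
  classical
  obtain ⟨j0, hj0⟩ := hz
  obtain ⟨j, hj, hmin⟩ := Finset.exists_min_image (Finset.univ.filter fun j => 0 < z j)
    (fun j => y j / z j) ⟨j0, by simpa using hj0⟩
  simp only [Finset.mem_filter, Finset.mem_univ, true_and] at hj hmin
  have hyj : 0 < y j := lt_of_le_of_ne (hy j) (fun h => hj.ne' (hs j h.symm))
  refine ⟨y j / z j, div_pos hyj hj, ?_, j, hj, by field_simp; ring⟩
  intro i
  by_cases hi : 0 < z i
  · have := hmin i hi
    rw [le_div_iff₀ hi] at this
    linarith
  · push Not at hi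
    have : y j / z j * z i ≤ 0 := mul_nonpos_of_nonneg_of_nonpos (div_pos hyj hj).le hi
    linarith [hy i]

theorem supp_lt {J : Type} [Fintype J] [DecidableEq J] (y z : J → ℝ)
    (hs : ∀ j, y j = 0 → z j = 0) (j : J) (hj : y j ≠ 0) (hz : z j = 0) :
    (Finset.univ.filter fun j => z j ≠ 0).card < (Finset.univ.filter fun j => y j ≠ 0).card := by
  apply Finset.card_lt_card
  rw [Finset.ssubset_iff_of_subset]
  · exact ⟨j, by simpa using hj, by simpa using hz⟩
  · intro i
    simp only [Finset.mem_filter, Finset.mem_univ, true_and]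
    exact fun h h' => h (hs i h')

/-- Existence of a bounded nonnegative integral kernel vector. -/
theorem exists_circuit {k : ℕ} {J : Type} [Fintype J] [DecidableEq J] (A : Matrix (Fin k) J ℤ)
    (w : J → ℝ) (hw0 : ∀ j, 0 ≤ w j) (hw : ∀ i j, |(A i j : ℝ)| ≤ w j) (B : ℝ)
    (hB : ∀ U : Finset J, U.card ≤ k → (Real.sqrt k) ^ U.card * ∏ j ∈ U, w j ≤ B) :
    ∀ (s : ℕ) (z : J → ℝ), (Finset.univ.filter fun j => z j ≠ 0).card = s →
      (∀ j, 0 ≤ z j) → z ≠ 0 → (A.map (Int.cast : ℤ → ℝ)).mulVec z = 0 →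
      ∃ q : J → ℕ, q ≠ 0 ∧ (∀ j, z j = 0 → q j = 0) ∧
        (A.map (Int.cast : ℤ → ℝ)).mulVec (fun j => (q j : ℝ)) = 0 ∧ ∀ j, (q j : ℝ) ≤ B := by
  intro s
  induction s using Nat.strong_induction_on with
  | _ s ih =>
  intro z hcard hz hz0 hAz
  obtain ⟨j0, hj0⟩ : ∃ j, z j ≠ 0 := by
    by_contra h
    push Not at h
    exact hz0 (funext h)
  set S := Finset.univ.filter fun j => z j ≠ 0 with hS
  set AR := A.map (Int.cast : ℤ → ℝ) with hAR
  have hj0S : j0 ∈ S := by simp [hS, hj0]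
  by_cases hLI : ∀ x : J → ℝ, (∀ j, j ∉ S.erase j0 → x j = 0) → AR.mulVec x = 0 → x = 0
  · obtain ⟨f, hf, hD, hC⟩ := cramer_main A (S.erase j0) hLI
    have hck : (S.erase j0).card ≤ k := by
      have := Fintype.card_le_of_injective f hf
      rwa [Fintype.card_coe, Fintype.card_fin] at this
    set D := (A.submatrix f (Subtype.val : ↥(S.erase j0) → J)).det with hDdef
    -- normalised vector
    have hz' : 0 < z j0 := lt_of_le_of_ne (hz j0) (Ne.symm hj0)
    let x : J → ℝ := fun j => if j = j0 then 0 else z j / z j0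
    have hx : ∀ j, j ∉ S.erase j0 → x j = 0 := by
      intro j hj
      by_cases h : j = j0
      · simp [x, h]
      · have : z j = 0 := by simpa [hS, h] using hj
        simp [x, this]
    have hAx : ∀ i, AR.mulVec x i = ((-A i j0 : ℤ) : ℝ) := by
      intro i
      have h1 : x = (z j0)⁻¹ • z - Pi.single j0 1 := by
        ext j
        by_cases h : j = j0
        · subst h; simp [x, hj0]
        · simp [x, h]; ring
      rw [h1, Matrix.mulVec_sub, Matrix.mulVec_smul, hAz]
      simp [hAR]
    have hDB : (|(D : ℝ)|) ≤ B := by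
      have h1 := hadamard_gen ((A.submatrix f (Subtype.val : ↥(S.erase j0) → J)).map
        (Int.cast : ℤ → ℝ)) (fun s => w s) (fun i j => by simpa using hw (f i) j)
      have hdd : (D : ℝ) = ((A.submatrix f (Subtype.val : ↥(S.erase j0) → J)).map
          (Int.cast : ℤ → ℝ)).det := by
        have := (Int.castRingHom ℝ).map_det (A.submatrix f (Subtype.val : ↥(S.erase j0) → J))
        simpa using this
      rw [hdd]
      refine h1.trans (le_trans ?_ (hB (S.erase j0) hck))
      rw [Finset.prod_coe_sort (S.erase j0) w, Fintype.card_coe]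
      have : 0 ≤ ∏ j ∈ S.erase j0, w j := Finset.prod_nonneg (fun j _ => hw0 j)
      gcongr
    have hq : ∀ j, ∃ q : ℕ, (q : ℝ) = |(D : ℝ)| * (z j / z j0) ∧ (q : ℝ) ≤ B := by
      intro j
      by_cases hjz : z j = 0
      · exact ⟨0, by simp [hjz], by simpa using (abs_nonneg _).trans hDB⟩
      by_cases hjj : j = j0
      · subst hjj
        have : ((D.natAbs : ℕ) : ℝ) = |(D : ℝ)| := by
          rw [Nat.cast_natAbs, Int.cast_abs]
        refine ⟨D.natAbs, ?_, ?_⟩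
        · rw [this]; field_simp
        · rw [this]; exact hDB
      · have hjT : j ∈ S.erase j0 := by simp [hS, hjj, hjz]
        have hc := hC x hx ⟨j, hjT⟩
        simp only [← hAR, hAx] at hc
        set E := ((A.submatrix f (Subtype.val : ↥(S.erase j0) → J)).updateCol ⟨j, hjT⟩
          (fun s => -A (f s) j0)).det with hE
        have hEE : (E : ℝ) = (((A.submatrix f (Subtype.val : ↥(S.erase j0) → J)).map
          (Int.cast : ℤ → ℝ)).updateCol ⟨j, hjT⟩ (fun s => ((-A (f s) j0 : ℤ) : ℝ))).det := by
          have := (Int.castRingHom ℝ).map_det ((A.submatrix f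
            (Subtype.val : ↥(S.erase j0) → J)).updateCol ⟨j, hjT⟩
              (fun s => -A (f s) j0))
          simp only [eq_intCast] at this
          rw [hE, this]
          congr 1
          ext a b
          by_cases hb : b = ⟨j, hjT⟩
          · subst hb; simp
          · simp [Matrix.updateCol_ne hb]
        have hEb := det_bound A w hw0 hw (S.erase j0) hck f ⟨j, hjT⟩
          (fun s => ((-A (f s) j0 : ℤ) : ℝ)) (w j0) (hw0 j0) (fun s => by
            simpa using hw (f s) j0)
        rw [← hEE] at hc hEb
        have hxj : x j = z j / z j0 := by simp [x, hjj]
        have hnn : 0 ≤ z j / z j0 := div_nonneg (hz j) hz'.le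
        have hab : |(E : ℝ)| = |(D : ℝ)| * (z j / z j0) := by
          rw [← hc, abs_mul]
          simp only [hxj, abs_of_nonneg hnn]
        have hn : ((E.natAbs : ℕ) : ℝ) = |(E : ℝ)| := by
          rw [Nat.cast_natAbs, Int.cast_abs]
        refine ⟨E.natAbs, by rw [hn, hab], ?_⟩
        rw [hn]
        refine hEb.trans (le_trans (le_of_eq ?_) (hB (S.erase j) ?_))
        · have hjS : j ∈ S := Finset.mem_of_mem_erase hjT
          rw [Finset.card_erase_of_mem hj0S, Finset.card_erase_of_mem hjS]
          congr 1
          have : (S.erase j0).erase j = (S.erase j).erase j0 := Finset.erase_right_comm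
          simp only [this]
          exact Finset.mul_prod_erase (S.erase j) w (by simp [hj0S, Ne.symm hjj])
        · have hjS : j ∈ S := Finset.mem_of_mem_erase hjT
          rw [Finset.card_erase_of_mem hjS]
          rwa [Finset.card_erase_of_mem hj0S] at hck
    choose q hq1 hq2 using hq
    have hDpos : 0 < |(D : ℝ)| := abs_pos.mpr (by exact_mod_cast hD)
    refine ⟨q, ?_, ?_, ?_, hq2⟩
    · intro h
      have := hq1 j0
      rw [h, div_self hj0] at this
      simp only [Pi.zero_apply, Nat.cast_zero, mul_one] at this
      exact hDpos.ne this
    · intro j hj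
      have := hq1 j
      rw [hj] at this
      simpa using this
    · have : (fun j => (q j : ℝ)) = (|(D : ℝ)| / z j0) • z := by
        ext j
        rw [hq1]
        simp
        ring
      rw [this, Matrix.mulVec_smul, hAz, smul_zero]
  · push Not at hLI
    obtain ⟨x, hx, hAx, hx0⟩ := hLI
    -- choose sign
    obtain ⟨x, hx, hAx, hpos⟩ : ∃ x : J → ℝ, (∀ j, j ∉ S.erase j0 → x j = 0) ∧
        AR.mulVec x = 0 ∧ ∃ j, 0 < x j := by
      obtain ⟨j, hj⟩ := Function.ne_iff.mp hx0
      rcases lt_or_gt_of_ne hj with h | h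
      · refine ⟨-x, fun j hj => by simp [hx j hj], by rw [Matrix.mulVec_neg, hAx, neg_zero], j, ?_⟩
        simpa using h
      · exact ⟨x, hx, hAx, j, h⟩
    have hsx : ∀ j, z j = 0 → x j = 0 := fun j hj => hx j (by simp [hS, hj])
    obtain ⟨t, ht, hnn, j1, hj1, hj1'⟩ := ratio_test z x hz hsx hpos
    have hs' : ∀ j, z j = 0 → (z - t • x) j = 0 := fun j hj => by simp [hj, hsx j hj]
    obtain ⟨q, h1, h2, h3, h4⟩ := ih _ (by
        rw [← hcard]
        exact supp_lt z (z - t • x) hs' j1 (fun h => hj1.ne' (hsx j1 h)) (by simpa using hj1'))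
      (z - t • x) rfl (fun j => by simpa using hnn j) (by
        intro h
        have := congrFun h j0
        simp [hx j0 (by simp)] at this
        exact hj0 this) (by rw [Matrix.mulVec_sub, Matrix.mulVec_smul, hAz, hAx]; simp)
    exact ⟨q, h1, fun j hj => h2 j (hs' j hj), h3, h4⟩

/-- Bound when there is no nonnegative kernel vector on the support. -/
theorem polytope_bound {k : ℕ} {J : Type} [Fintype J] [DecidableEq J] (A : Matrix (Fin k) J ℤ)
    (w : J → ℝ) (hw1 : ∀ j, 1 ≤ w j) (hw : ∀ i j, |(A i j : ℝ)| ≤ w j) (B : ℝ)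
    (hB : ∀ U : Finset J, U.card ≤ k → (Real.sqrt k) ^ U.card * ∏ j ∈ U, w j ≤ B)
    (c : Fin k → ℝ) (L : ℝ) (hL : 0 ≤ L) (hc : ∀ i, |c i| ≤ L) (j0 : J) :
    ∀ (s : ℕ) (y : J → ℝ), (Finset.univ.filter fun j => y j ≠ 0).card = s →
      (∀ j, 0 ≤ y j) → (A.map (Int.cast : ℤ → ℝ)).mulVec y = c →
      (∀ z : J → ℝ, (∀ j, y j = 0 → z j = 0) → (∀ j, 0 ≤ z j) →
        (A.map (Int.cast : ℤ → ℝ)).mulVec z = 0 → z = 0) →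
      y j0 ≤ L * B := by
  have hw0 : ∀ j, 0 ≤ w j := fun j => zero_le_one.trans (hw1 j)
  have hB0 : 0 ≤ B := le_trans (by simp) (hB ∅ (by simp))
  intro s
  induction s using Nat.strong_induction_on with
  | _ s ih =>
  intro y hcard hy hAy hno
  set S := Finset.univ.filter fun j => y j ≠ 0 with hS
  set AR := A.map (Int.cast : ℤ → ℝ) with hAR
  by_cases hj0 : y j0 = 0
  · rw [hj0]; positivity
  have hj0S : j0 ∈ S := by simp [hS, hj0]
  by_cases hLI : ∀ x : J → ℝ, (∀ j, j ∉ S → x j = 0) → AR.mulVec x = 0 → x = 0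
  · obtain ⟨f, hf, hD, hC⟩ := cramer_main A S hLI
    have hck : S.card ≤ k := by
      have := Fintype.card_le_of_injective f hf
      rwa [Fintype.card_coe, Fintype.card_fin] at this
    have h1 := hC y (fun j hj => by simpa [hS] using hj) ⟨j0, hj0S⟩
    have h2 := det_bound A w hw0 hw S hck f ⟨j0, hj0S⟩ (fun s => AR.mulVec y (f s)) L hL
      (fun s => by rw [hAy]; exact hc _)
    rw [← h1, abs_mul, abs_of_nonneg (hy j0)] at h2
    have hD1 : (1 : ℝ) ≤ |((A.submatrix f (Subtype.val : S → J)).det : ℝ)| := by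
      exact_mod_cast Int.one_le_abs hD
    have h3 : y j0 ≤ |((A.submatrix f (Subtype.val : S → J)).det : ℝ)| * y j0 :=
      le_mul_of_one_le_left (hy j0) hD1
    refine h3.trans (h2.trans ?_)
    have h4 : ∏ j ∈ S.erase j0, w j ≤ ∏ j ∈ S, w j := by
      rw [← Finset.mul_prod_erase S w hj0S]
      exact le_mul_of_one_le_left (Finset.prod_nonneg (fun j _ => hw0 j)) (hw1 j0)
    calc Real.sqrt k ^ S.card * (L * ∏ j ∈ S.erase j0, w j)
        ≤ Real.sqrt k ^ S.card * (L * ∏ j ∈ S, w j) := by gcongr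
      _ = L * (Real.sqrt k ^ S.card * ∏ j ∈ S, w j) := by ring
      _ ≤ L * B := by gcongr; exact hB S hck
  · push Not at hLI
    obtain ⟨x, hx, hAx, hx0⟩ := hLI
    -- choose sign: x j0 ≤ 0
    obtain ⟨x, hx, hAx, hx0, hneg⟩ : ∃ x : J → ℝ, (∀ j, j ∉ S → x j = 0) ∧
        AR.mulVec x = 0 ∧ x ≠ 0 ∧ x j0 ≤ 0 := by
      rcases le_total (x j0) 0 with h | h
      · exact ⟨x, hx, hAx, hx0, h⟩
      · exact ⟨-x, fun j hj => by simp [hx j hj], by rw [Matrix.mulVec_neg, hAx, neg_zero],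
          neg_ne_zero.mpr hx0, by simpa using h⟩
    have hsx : ∀ j, y j = 0 → x j = 0 := fun j hj => hx j (by simp [hS, hj])
    have hpos : ∃ j, 0 < x j := by
      by_contra h
      push Not at h
      apply hx0
      have := hno (-x) (fun j hj => by simp [hsx j hj]) (fun j => by simpa using h j)
        (by rw [Matrix.mulVec_neg, hAx, neg_zero])
      simpa using this
    obtain ⟨t, ht, hnn, j1, hj1, hj1'⟩ := ratio_test y x hy hsx hpos
    have hs' : ∀ j, y j = 0 → (y - t • x) j = 0 := fun j hj => by simp [hj, hsx j hj]
    have := ih _ (by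
        rw [← hcard]
        exact supp_lt y (y - t • x) hs' j1 (fun h => hj1.ne' (hsx j1 h)) (by simpa using hj1'))
      (y - t • x) rfl (fun j => by simpa using hnn j)
      (by rw [Matrix.mulVec_sub, Matrix.mulVec_smul, hAy, hAx]; simp)
      (fun z hz => hno z (fun j hj => hz j (hs' j hj)))
    refine le_trans ?_ this
    simp only [Pi.sub_apply, Pi.smul_apply, smul_eq_mul]
    have := mul_nonpos_of_nonneg_of_nonpos ht.le hneg
    linarith

theorem decomp_real {k : ℕ} {J : Type} [Fintype J] [DecidableEq J] (A : Matrix (Fin k) J ℤ)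
    (w : J → ℝ) (hw1 : ∀ j, 1 ≤ w j) (hw : ∀ i j, |(A i j : ℝ)| ≤ w j) (B : ℝ)
    (hB : ∀ U : Finset J, U.card ≤ k → (Real.sqrt k) ^ U.card * ∏ j ∈ U, w j ≤ B)
    (c : Fin k → ℝ) (L : ℝ) (hL : 0 ≤ L) (hc : ∀ i, |c i| ≤ L) :
    ∀ (s : ℕ) (y : J → ℝ), (Finset.univ.filter fun j => y j ≠ 0).card = s →
      (∀ j, 0 ≤ y j) → (A.map (Int.cast : ℤ → ℝ)).mulVec y = c →
      (∀ j, y j ≤ L * B + s * B) ∨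
      ∃ q : J → ℕ, q ≠ 0 ∧ (∀ j, (q j : ℝ) ≤ y j) ∧
        (A.map (Int.cast : ℤ → ℝ)).mulVec (fun j => (q j : ℝ)) = 0 ∧ ∀ j, (q j : ℝ) ≤ B := by
  have hw0 : ∀ j, 0 ≤ w j := fun j => zero_le_one.trans (hw1 j)
  have hB0 : 0 ≤ B := le_trans (by simp) (hB ∅ (by simp))
  intro s
  induction s using Nat.strong_induction_on with
  | _ s ih =>
  intro y hcard hy hAy
  by_cases hno : ∀ z : J → ℝ, (∀ j, y j = 0 → z j = 0) → (∀ j, 0 ≤ z j) →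
        (A.map (Int.cast : ℤ → ℝ)).mulVec z = 0 → z = 0
  · left
    intro j
    have := polytope_bound A w hw1 hw B hB c L hL hc j s y hcard hy hAy hno
    have : 0 ≤ (s : ℝ) * B := by positivity
    linarith
  push Not at hno
  obtain ⟨z, hz1, hz2, hz3, hz4⟩ := hno
  obtain ⟨q, hq1, hq2, hq3, hq4⟩ := exists_circuit A w hw0 hw B hB _ z rfl hz2 hz4 hz3
  have hsx : ∀ j, y j = 0 → (q j : ℝ) = 0 := fun j hj => by simp [hq2 j (hz1 j hj)]
  obtain ⟨t, ht, hnn, j1, hj1, hj1'⟩ := ratio_test y (fun j => (q j : ℝ)) hy hsx (by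
    obtain ⟨j, hj⟩ := Function.ne_iff.mp hq1
    exact ⟨j, by exact_mod_cast Nat.pos_of_ne_zero hj⟩)
  rcases le_or_gt 1 t with h1 | h1
  · right
    refine ⟨q, hq1, fun j => ?_, hq3, hq4⟩
    have := hnn j
    have h2 : (q j : ℝ) ≤ t * q j := le_mul_of_one_le_left (Nat.cast_nonneg _) h1
    linarith
  have hs' : ∀ j, y j = 0 → (y - t • (fun j => (q j : ℝ))) j = 0 := fun j hj => by
    have := hsx j hj
    simp only [Pi.sub_apply, Pi.smul_apply, smul_eq_mul, this, hj]; simp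
  have hlt := supp_lt y (y - t • (fun j => (q j : ℝ))) hs' j1 (fun h => hj1.ne' (hsx j1 h))
    (by simpa using hj1')
  rw [hcard] at hlt
  rcases ih _ hlt (y - t • (fun j => (q j : ℝ))) rfl (fun j => by simpa using hnn j)
    (by rw [Matrix.mulVec_sub, Matrix.mulVec_smul, hAy, hq3]; simp) with h | ⟨q', a, b, c', d⟩
  · left
    intro j
    have h2 := h j
    simp only [Pi.sub_apply, Pi.smul_apply, smul_eq_mul] at h2
    have h3 : t * q j ≤ B := by
      have : t * q j ≤ 1 * q j := by gcongr
      linarith [hq4 j]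
    have h4 : ((Finset.univ.filter fun j => (y - t • (fun j => (q j : ℝ))) j ≠ 0).card : ℝ) + 1
        ≤ s := by exact_mod_cast hlt
    have h5 := mul_le_mul_of_nonneg_right h4 hB0
    simp only [Pi.sub_apply, Pi.smul_apply, smul_eq_mul] at h5
    linarith
  · right
    refine ⟨q', a, fun j => ?_, c', d⟩
    have h2 := b j
    simp only [Pi.sub_apply, Pi.smul_apply, smul_eq_mul] at h2
    have : 0 ≤ t * (q j : ℝ) := by positivity
    linarith

theorem mem_LSet1_iff {k : ℕ} (c : Fin k → ℕ) (P : Finset (Fin k → ℕ)) (v : Fin k → ℕ) :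
    v ∈ LSet1 c P ↔ ∃ μ : P → ℕ, ∀ r, v r = c r + ∑ p : P, μ p * p.1 r := by
  classical
  constructor
  · rintro ⟨c', hc', lam, rfl⟩
    rw [Finset.mem_singleton] at hc'
    subst hc'
    refine ⟨fun p => lam p, fun r => ?_⟩
    simp only [Pi.add_apply, Finset.sum_apply, Pi.smul_apply, smul_eq_mul]
    rw [Finset.sum_coe_sort P (fun p => lam p * p r)]
  · rintro ⟨μ, hμ⟩
    refine ⟨c, by simp, fun p => if h : p ∈ P then μ ⟨p, h⟩ else 0, ?_⟩
    ext r
    rw [hμ r]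
    simp only [Pi.add_apply, Finset.sum_apply, Pi.smul_apply, smul_eq_mul]
    rw [← Finset.sum_coe_sort P]
    simp

theorem LSet_add_mem {k : ℕ} (C Q : Finset (Fin k → ℕ)) (v q : Fin k → ℕ)
    (hv : v ∈ LSet C Q) (hq : q ∈ Q) : v + q ∈ LSet C Q := by
  classical
  obtain ⟨c, hc, lam, rfl⟩ := hv
  refine ⟨c, hc, lam + Pi.single q 1, ?_⟩
  simp only [Pi.add_apply, add_smul, Finset.sum_add_distrib]
  rw [add_assoc]
  congr 2
  rw [Finset.sum_eq_single q]
  · simp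
  · intro b _ hb
    simp [hb]
  · exact fun h => absurd hq h

theorem LSet1_add {k : ℕ} (c d : Fin k → ℕ) (P : Finset (Fin k → ℕ)) (v q : Fin k → ℕ)
    (hv : v ∈ LSet1 c P) (hq : q ∈ LSet1 d P) : v + q ∈ LSet1 (c + d) P := by
  rw [mem_LSet1_iff] at *
  obtain ⟨μ, hμ⟩ := hv
  obtain ⟨ν, hν⟩ := hq
  refine ⟨μ + ν, fun r => ?_⟩
  simp only [Pi.add_apply, hμ r, hν r, add_mul, Finset.sum_add_distrib]
  ring

theorem LSet1_zero_mem {k : ℕ} (c : Fin k → ℕ) (P : Finset (Fin k → ℕ)) :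
    c ∈ LSet1 c P := by
  rw [mem_LSet1_iff]
  exact ⟨0, fun r => by simp⟩

theorem LSet_sub_pre {k₁ k₂ : ℕ} (H : Matrix (Fin k₂) (Fin k₁) ℕ) (c : Fin k₂ → ℕ)
    (P : Finset (Fin k₂ → ℕ)) (C Q : Finset (Fin k₁ → ℕ))
    (hC : ∀ x ∈ C, H.mulVec x ∈ LSet1 c P) (hQ : ∀ x ∈ Q, H.mulVec x ∈ LSet1 0 P)
    (x : Fin k₁ → ℕ) (hx : x ∈ LSet C Q) : H.mulVec x ∈ LSet1 c P := by
  classical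
  obtain ⟨d, hd, lam, rfl⟩ := hx
  have h1 : ∀ (q : Fin k₁ → ℕ) (t : ℕ), H.mulVec q ∈ LSet1 0 P → H.mulVec (t • q) ∈ LSet1 0 P := by
    intro q t hq
    induction t with
    | zero => simpa using LSet1_zero_mem 0 P
    | succ t ih =>
      rw [succ_nsmul, Matrix.mulVec_add]
      simpa using LSet1_add _ _ P _ _ ih hq
  have h2 : ∀ s : Finset (Fin k₁ → ℕ), s ⊆ Q →
      H.mulVec (∑ x ∈ s, lam x • x) ∈ LSet1 0 P := by
    intro s
    induction s using Finset.induction_on with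
    | empty => intro _; simpa using LSet1_zero_mem 0 P
    | insert a s ha ih =>
      intro hs
      rw [Finset.sum_insert ha, Matrix.mulVec_add]
      have := LSet1_add _ _ P _ _ (h1 a (lam a) (hQ a (hs (Finset.mem_insert_self _ _))))
        (ih (fun x hx => hs (Finset.mem_insert_of_mem hx)))
      simpa using this
  rw [Matrix.mulVec_add]
  simpa using LSet1_add _ _ P _ _ (hC d hd) (h2 Q (Finset.Subset.refl _))

theorem weight_bound {k₁ k₂ : ℕ} (hk₂ : 1 ≤ k₂) {T : Type} [Fintype T] (m : ℕ)
    (hm : Fintype.card T ≤ m) (a b : ℝ) (ha : 1 ≤ a) (hb : 1 ≤ b)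
    (U : Finset (Fin k₁ ⊕ T)) (hU : U.card ≤ k₂) :
    (Real.sqrt k₂) ^ U.card * ∏ j ∈ U, Sum.elim (fun _ => a) (fun _ => b) j ≤
      (k₂ : ℝ) ^ (((min (k₁ + m) k₂ : ℕ) : ℝ) / 2) * a ^ (min k₁ k₂) * b ^ (min m k₂) := by
  classical
  have hp : ∏ j ∈ U, Sum.elim (fun _ => a) (fun _ => b) j = a ^ U.toLeft.card * b ^ U.toRight.card := by
    conv_lhs => rw [← Finset.toLeft_disjSum_toRight (u := U)]
    rw [Finset.prod_disjSum]
    simp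
  have hcard : U.toLeft.card + U.toRight.card = U.card := Finset.card_toLeft_add_card_toRight
  have hl : U.toLeft.card ≤ k₁ := by simpa using Finset.card_le_univ U.toLeft
  have hr : U.toRight.card ≤ m := (Finset.card_le_univ U.toRight).trans hm
  have hk : (1 : ℝ) ≤ k₂ := by exact_mod_cast hk₂
  have hs : (Real.sqrt k₂) ^ U.card ≤ (k₂ : ℝ) ^ (((min (k₁ + m) k₂ : ℕ) : ℝ) / 2) := by
    rw [Real.sqrt_eq_rpow, ← Real.rpow_natCast, ← Real.rpow_mul (by positivity)]
    apply Real.rpow_le_rpow_of_exponent_le hk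
    have : (U.card : ℝ) ≤ ((min (k₁ + m) k₂ : ℕ) : ℝ) := by
      exact_mod_cast le_min (by omega) hU
    linarith
  rw [hp, ← mul_assoc]
  gcongr
  · exact le_min hl (by omega)
  · exact le_min hr (by omega)

theorem per_index (k₁ k₂ : ℕ) (hk₂ : 1 ≤ k₂)
    (c : Fin k₂ → ℕ) (P : Finset (Fin k₂ → ℕ)) (n m ℓ : ℕ)
    (hn : ∀ p ∈ P, ∀ r, p r ≤ n) (hm : P.card ≤ m) (hℓ : ∀ r, c r ≤ ℓ)
    (H : Matrix (Fin k₂) (Fin k₁) ℕ) (NH : ℕ) (hNH : ∀ r s, H r s ≤ NH)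
    (B : ℝ) (hBdef : B = (k₂ : ℝ) ^ (((min (k₁ + m) k₂ : ℕ) : ℝ) / 2) *
          ((NH : ℝ) + 1) ^ (min k₁ k₂) * ((n : ℝ) + 1) ^ (min m k₂)) :
    ∃ Q C : Finset (Fin k₁ → ℕ),
      (∀ q ∈ Q, ∀ s, (q s : ℝ) ≤ ((k₁ : ℝ) + m + 1) * B) ∧
      (∀ q ∈ C, ∀ s, (q s : ℝ) ≤ ((k₁ : ℝ) + m + 1) * B * ℓ) ∧
      ∀ x, H.mulVec x ∈ LSet1 c P ↔ x ∈ LSet C Q := by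
  classical
  set K : ℝ := (k₁ : ℝ) + m + 1 with hK
  have hB0 : 0 ≤ B := by rw [hBdef]; positivity
  let box : ℝ → Finset (Fin k₁ → ℕ) := fun R => Fintype.piFinset fun _ => Finset.range (⌊R⌋₊ + 1)
  have hbox : ∀ R : ℝ, 0 ≤ R → ∀ x, x ∈ box R ↔ ∀ s, (x s : ℝ) ≤ R := by
    intro R hR x
    simp only [box, Fintype.mem_piFinset, Finset.mem_range, Nat.lt_succ_iff]
    exact forall_congr' fun s => Nat.le_floor_iff hR
  have hKB : 0 ≤ K * B := by positivity
  have hKBl : 0 ≤ K * B * ℓ := by positivity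
  let Q := (box (K * B)).filter fun x => H.mulVec x ∈ LSet1 0 P
  let C := (box (K * B * ℓ)).filter fun x => H.mulVec x ∈ LSet1 c P
  have hQ : ∀ x, x ∈ Q ↔ (∀ s, (x s : ℝ) ≤ K * B) ∧ H.mulVec x ∈ LSet1 0 P := fun x => by
    simp only [Q, Finset.mem_filter, hbox _ hKB]
  have hC : ∀ x, x ∈ C ↔ (∀ s, (x s : ℝ) ≤ K * B * ℓ) ∧ H.mulVec x ∈ LSet1 c P := fun x => by
    simp only [C, Finset.mem_filter, hbox _ hKBl]
  refine ⟨Q, C, fun q hq => ((hQ q).1 hq).1, fun q hq => ((hC q).1 hq).1, fun x => ⟨?_, ?_⟩⟩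
  swap
  · exact LSet_sub_pre H c P C Q (fun x hx => ((hC x).1 hx).2) (fun x hx => ((hQ x).1 hx).2) x
  -- the matrix
  let A : Matrix (Fin k₂) (Fin k₁ ⊕ P) ℤ :=
    Matrix.of fun r => Sum.elim (fun s => (H r s : ℤ)) (fun p => -(p.1 r : ℤ))
  let w : Fin k₁ ⊕ P → ℝ := Sum.elim (fun _ => (NH : ℝ) + 1) (fun _ => (n : ℝ) + 1)
  have hw1 : ∀ j, 1 ≤ w j := by rintro (j | j) <;> simp [w]
  have hw : ∀ i j, |(A i j : ℝ)| ≤ w j := by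
    rintro i (j | j)
    · have : (H i j : ℝ) ≤ NH := by exact_mod_cast hNH i j
      simp [A, w]; linarith
    · have : (j.1 i : ℝ) ≤ n := by exact_mod_cast hn j.1 j.2 i
      simp [A, w]; linarith
  have hB : ∀ U : Finset (Fin k₁ ⊕ P), U.card ≤ k₂ →
      (Real.sqrt k₂) ^ U.card * ∏ j ∈ U, w j ≤ B := by
    intro U hU
    rw [hBdef]
    exact weight_bound hk₂ m (by simpa using hm) _ _ (by simp) (by simp) U hU
  have hsol : ∀ (d : Fin k₂ → ℕ) (y : Fin k₁ ⊕ P → ℕ),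
      (A.map (Int.cast : ℤ → ℝ)).mulVec (fun j => (y j : ℝ)) = (fun r => (d r : ℝ)) ↔
      ∀ r, H.mulVec (fun s => y (Sum.inl s)) r = d r + ∑ p : P, y (Sum.inr p) * p.1 r := by
    intro d y
    rw [funext_iff]
    refine forall_congr' fun r => ?_
    rw [← Nat.cast_inj (R := ℝ)]
    simp only [Matrix.mulVec, dotProduct, Fintype.sum_sum_type, Matrix.map_apply, A, Matrix.of_apply,
      Sum.elim_inl, Sum.elim_inr]
    push_cast
    simp only [neg_mul, Finset.sum_neg_distrib]
    simp only [mul_comm (_ : ℝ) (y (Sum.inr _) : ℝ)]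
    constructor <;> intro h <;> linarith
  have hpre : ∀ (d : Fin k₂ → ℕ) (y : Fin k₁ ⊕ P → ℕ),
      (A.map (Int.cast : ℤ → ℝ)).mulVec (fun j => (y j : ℝ)) = (fun r => (d r : ℝ)) →
      H.mulVec (fun s => y (Sum.inl s)) ∈ LSet1 d P := fun d y h =>
    (mem_LSet1_iff _ _ _).2 ⟨fun p => y (Sum.inr p), (hsol d y).1 h⟩
  have hcardle : ∀ y : Fin k₁ ⊕ P → ℝ,
      ((Finset.univ.filter fun j => y j ≠ 0).card : ℝ) ≤ k₁ + m := by
    intro y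
    have h1 : (Finset.univ.filter fun j => y j ≠ 0).card ≤ k₁ + m := by
      refine (Finset.card_le_univ _).trans ?_
      simpa using hm
    exact_mod_cast h1
  have main : ∀ (N : ℕ) (y : Fin k₁ ⊕ P → ℕ), ∑ j, y j = N →
      (A.map (Int.cast : ℤ → ℝ)).mulVec (fun j => (y j : ℝ)) = (fun r => (c r : ℝ)) →
      (fun s => y (Sum.inl s)) ∈ LSet C Q := by
    intro N
    induction N using Nat.strong_induction_on with
    | _ N ih =>
    intro y hN hy
    rcases decomp_real A w hw1 hw B hB (fun r => (c r : ℝ)) ℓ (Nat.cast_nonneg _)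
      (fun r => by simpa using hℓ r) _ (fun j => (y j : ℝ)) rfl
      (fun j => Nat.cast_nonneg _) hy with h | ⟨q, hq0, hqy, hAq, hqB⟩
    · have hc' := hcardle (fun j => (y j : ℝ))
      have hc'' := mul_le_mul_of_nonneg_right hc' hB0
      have hbd : ∀ j, (y j : ℝ) ≤ ℓ * B + (k₁ + m) * B := fun j => by linarith [h j]
      rcases Nat.eq_zero_or_pos ℓ with hl | hl
      · have hc0 : c = 0 := by
          ext r
          have := hℓ r
          simp; omega
        have h0C : (0 : Fin k₁ → ℕ) ∈ C := by
          rw [hC]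
          refine ⟨fun s => by simpa using hKBl, ?_⟩
          rw [hc0]
          simpa using LSet1_zero_mem 0 P
        have hyQ : (fun s => y (Sum.inl s)) ∈ Q := by
          rw [hQ]
          refine ⟨fun s => ?_, ?_⟩
          · have := hbd (Sum.inl s)
            rw [hl] at this
            simp only [Nat.cast_zero, zero_mul, zero_add] at this
            rw [hK]; linarith
          · rw [← hc0]; exact hpre c y hy
        have h00 : (0 : Fin k₁ → ℕ) ∈ LSet C Q := ⟨0, h0C, 0, by simp⟩
        simpa using LSet_add_mem C Q 0 _ h00 hyQ
      · have hyC : (fun s => y (Sum.inl s)) ∈ C := by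
          rw [hC]
          refine ⟨fun s => ?_, hpre c y hy⟩
          have h1 := hbd (Sum.inl s)
          have hl1 : (1 : ℝ) ≤ ℓ := by exact_mod_cast hl
          have h2 : ((k₁ : ℝ) + m) * B ≤ ((k₁ : ℝ) + m) * B * ℓ :=
            le_mul_of_one_le_right (by positivity) hl1
          have h3 : K * B * ℓ = ℓ * B + (k₁ + m) * B * ℓ := by rw [hK]; ring
          linarith
        exact ⟨_, hyC, 0, by simp⟩
    · have hqy' : ∀ j, q j ≤ y j := fun j => by exact_mod_cast hqy j
      have hsum : ∑ j, (y j - q j) < N := by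
        rw [← hN]
        obtain ⟨j, hj⟩ := Function.ne_iff.mp hq0
        apply Finset.sum_lt_sum (fun i _ => Nat.sub_le _ _)
        refine ⟨j, Finset.mem_univ _, ?_⟩
        have := hqy' j
        have : q j ≠ 0 := hj
        omega
      have hrec := ih _ hsum (fun j => y j - q j) rfl (by
        have : (fun j => ((y j - q j : ℕ) : ℝ)) = (fun j => (y j : ℝ)) - (fun j => (q j : ℝ)) := by
          ext j
          simp [Nat.cast_sub (hqy' j)]
        rw [this, Matrix.mulVec_sub, hy, hAq, sub_zero])
      have hqQ : (fun s => q (Sum.inl s)) ∈ Q := by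
        rw [hQ]
        refine ⟨fun s => ?_, ?_⟩
        · have h1 : (1 : ℝ) ≤ K := by
            rw [hK]
            have : (0 : ℝ) ≤ (k₁ : ℝ) + m := by positivity
            linarith
          exact (hqB _).trans (le_mul_of_one_le_left hB0 h1)
        · apply hpre 0 q
          rw [hAq]
          ext r; simp
      have := LSet_add_mem C Q _ _ hrec hqQ
      convert this using 1
      ext s
      simp [Nat.sub_add_cancel (hqy' (Sum.inl s))]
  intro hx
  obtain ⟨μ, hμ⟩ := (mem_LSet1_iff _ _ _).1 hx
  exact main _ (Sum.elim x μ) rfl ((hsol c (Sum.elim x μ)).2 (by simpa using hμ))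

/-- Inverse homomorphism of a semilinear set under `x ↦ H x`, with bounds on
the norms of the resulting period and constant sets. -/
theorem invhom_semilinear {ι : Type*} (k₁ k₂ : ℕ) (hk₁ : 1 ≤ k₁) (hk₂ : 1 ≤ k₂)
    (I : Finset ι) (c : ι → (Fin k₂ → ℕ)) (P : ι → Finset (Fin k₂ → ℕ))
    (n m ℓ : ℕ)
    (hn : n = I.sup fun i => snorm (P i))
    (hm : m = I.sup fun i => (P i).card)
    (hℓ : ℓ = I.sup fun i => vnorm (c i))
    (H : Matrix (Fin k₂) (Fin k₁) ℕ) (NH : ℕ)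
    (hNH : NH = Finset.univ.sup fun ij : Fin k₂ × Fin k₁ => H ij.1 ij.2)
    (h : (Fin k₁ → ℕ) → (Fin k₂ → ℕ)) (hh : ∀ v, h v = H.mulVec v) :
    ∃ Q C : ι → Finset (Fin k₁ → ℕ),
      (∀ i ∈ I,
        (snorm (Q i) : ℝ) ≤ ((k₁ : ℝ) + (m : ℝ) + 1) *
          (k₂ : ℝ) ^ (((min (k₁ + m) k₂ : ℕ) : ℝ) / 2) *
          ((NH : ℝ) + 1) ^ (min k₁ k₂) * ((n : ℝ) + 1) ^ (min m k₂) ∧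
        (snorm (C i) : ℝ) ≤ ((k₁ : ℝ) + (m : ℝ) + 1) *
          (k₂ : ℝ) ^ (((min (k₁ + m) k₂ : ℕ) : ℝ) / 2) *
          ((NH : ℝ) + 1) ^ (min k₁ k₂) * ((n : ℝ) + 1) ^ (min m k₂) * (ℓ : ℝ)) ∧
      h ⁻¹' (⋃ i ∈ I, LSet1 (c i) (P i)) = ⋃ i ∈ I, LSet (C i) (Q i) := by
  classical
  have hper : ∀ i ∈ I, ∃ Q C : Finset (Fin k₁ → ℕ),
      (∀ q ∈ Q, ∀ s, (q s : ℝ) ≤ ((k₁ : ℝ) + m + 1) *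
        ((k₂ : ℝ) ^ (((min (k₁ + m) k₂ : ℕ) : ℝ) / 2) *
          ((NH : ℝ) + 1) ^ (min k₁ k₂) * ((n : ℝ) + 1) ^ (min m k₂))) ∧
      (∀ q ∈ C, ∀ s, (q s : ℝ) ≤ ((k₁ : ℝ) + m + 1) *
        ((k₂ : ℝ) ^ (((min (k₁ + m) k₂ : ℕ) : ℝ) / 2) *
          ((NH : ℝ) + 1) ^ (min k₁ k₂) * ((n : ℝ) + 1) ^ (min m k₂)) * ℓ) ∧
      ∀ x, H.mulVec x ∈ LSet1 (c i) (P i) ↔ x ∈ LSet C Q := by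
    intro i hi
    apply per_index k₁ k₂ hk₂ (c i) (P i) n m ℓ _ _ _ H NH _ _ rfl
    · intro p hp r
      have h1 : snorm (P i) ≤ n := by
        rw [hn]; exact Finset.le_sup (f := fun i => snorm (P i)) hi
      have h2 : vnorm p ≤ snorm (P i) := Finset.le_sup (f := vnorm) hp
      have h3 : p r ≤ vnorm p := Finset.le_sup (f := p) (Finset.mem_univ r)
      omega
    · rw [hm]; exact Finset.le_sup (f := fun i => (P i).card) hi
    · intro r
      have h1 : vnorm (c i) ≤ ℓ := by
        rw [hℓ]; exact Finset.le_sup (f := fun i => vnorm (c i)) hi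
      have h3 : c i r ≤ vnorm (c i) := Finset.le_sup (f := c i) (Finset.mem_univ r)
      omega
    · intro r s
      rw [hNH]
      exact Finset.le_sup (f := fun ij : Fin k₂ × Fin k₁ => H ij.1 ij.2) (Finset.mem_univ (r, s))
  have hsn : ∀ (S : Finset (Fin k₁ → ℕ)) (R : ℝ), 0 ≤ R → (∀ q ∈ S, ∀ s, (q s : ℝ) ≤ R) →
      (snorm S : ℝ) ≤ R := by
    intro S R hR hS
    rw [← Nat.le_floor_iff hR]
    apply Finset.sup_le
    intro q hq
    apply Finset.sup_le
    intro s _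
    exact (Nat.le_floor_iff hR).2 (hS q hq s)
  choose! Q C hQ hC hQC using hper
  refine ⟨Q, C, fun i hi => ⟨?_, ?_⟩, ?_⟩
  · apply hsn _ _ (by positivity)
    intro q hq s
    have := hQ i hi q hq s
    simpa only [mul_assoc] using this
  · apply hsn _ _ (by positivity)
    intro q hq s
    have := hC i hi q hq s
    simpa only [mul_assoc] using this
  · ext x
    simp only [Set.mem_preimage, Set.mem_iUnion, hh]
    exact exists_congr fun i => exists_congr fun hi => hQC i hi x
end

section
/- Let k ≥ 1, let P ⊆ ℕ^k be a finite set of vectors, and let x₀ ∈ ℕ^k. Let G = { y ∈ ℕ^k : x₀ ≤ y is false } (componentwise order). Then ℕ^k \ L(x₀, P) = G ∪ ((ℕ^k \ L(0, P)) + x₀), where S + x₀ denotes the translate { s + x₀ : s ∈ S }. Moreover, G = ⋃_{j=1}^{k} L(D_j, Q_j), where D_j = { y ∈ ℕ^k : y_ℓ = 0 for ℓ ≠ j and y_j < (x₀)_j } and Q_j is the set of all standard unit vectors of ℕ^k except the j-th. -/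
/-- Splitting the complement of `L(x₀,P)`: it is the union of the set `G` of
vectors not componentwise above `x₀` together with the translate by `x₀` of the
complement of `L(0,P)`; moreover `G = ⋃_j L(D_j, Q_j)`. -/
theorem compl_linear_split (k : ℕ) (hk : 1 ≤ k)
    (P : Finset (Fin k → ℕ)) (x₀ : Fin k → ℕ)
    (G : Set (Fin k → ℕ)) (hG : G = {y | ¬ x₀ ≤ y})
    (D : Fin k → Finset (Fin k → ℕ))
    (hD : ∀ j, D j = (Finset.range (x₀ j)).image fun lam => fun i => if i = j then lam else 0)
    (Q : Fin k → Finset (Fin k → ℕ))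
    (hQ : ∀ j, Q j = (Finset.univ.erase j).image fun i => Pi.single i 1) :
    (LSet1 x₀ P)ᶜ = G ∪ ((· + x₀) '' (LSet1 (0 : Fin k → ℕ) P)ᶜ) ∧
    G = ⋃ j : Fin k, LSet (D j) (Q j) := by
  subst hG
  have key : ∀ j (lam : (Fin k → ℕ) → ℕ),
      ∑ x ∈ Q j, lam x • x = fun i => if i = j then 0 else lam (Pi.single i 1) := by
    intro j lam
    rw [hQ, Finset.sum_image]
    · funext i
      rw [Finset.sum_apply]
      simp only [Pi.smul_apply, smul_eq_mul, Pi.single_apply, mul_ite, mul_one, mul_zero]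
      rw [Finset.sum_ite_eq]
      by_cases h : i = j <;> simp [h]
    · intro a _ b _ h
      by_contra hab
      have := congrFun h a
      simp [Pi.single_apply, hab] at this
  constructor
  · ext y
    simp only [LSet1, LSet, Set.mem_compl_iff, Set.mem_setOf_eq, Finset.mem_singleton,
      exists_eq_left, Set.mem_union, Set.mem_image, zero_add]
    constructor
    · intro h
      by_cases hy : x₀ ≤ y
      · right
        refine ⟨y - x₀, ?_, tsub_add_cancel_of_le hy⟩
        rintro ⟨lam, hl⟩
        exact h ⟨lam, by rw [← hl, add_tsub_cancel_of_le hy]⟩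
      · exact Or.inl hy
    · rintro (h | ⟨s, hs, rfl⟩) ⟨lam, hl⟩
      · apply h
        rw [hl]
        exact le_self_add
      · exact hs ⟨lam, by rw [add_comm] at hl; exact add_left_cancel hl⟩
  · ext y
    simp only [Set.mem_setOf_eq, Set.mem_iUnion, LSet, key, hD, Finset.mem_image,
      Finset.mem_range]
    constructor
    · intro h
      rw [Pi.le_def] at h
      push Not at h
      obtain ⟨j, hj⟩ := h
      refine ⟨j, _, ⟨y j, hj, rfl⟩, fun x => ∑ i, x i * y i, ?_⟩
      funext i
      by_cases h : i = j
      · subst h; simp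
      · simp [h, Pi.single_apply]
    · rintro ⟨j, c, ⟨a, ha, rfl⟩, lam, rfl⟩ h
      have := h j
      simp at this
      omega
end

section
/- Let k ≥ 2, let P = {x₁, …, x_m} ⊆ ℕ^k be a finite set of m ≥ 2 distinct vectors that is linearly dependent over ℚ, with ‖P‖ = n, and let x₀ ∈ ℕ^k. Then there exist p with 1 ≤ p ≤ ⌊m/2⌋, an enumeration of P as x₁, …, x_p, y₁, …, y_{m−p}, and a vector a ∈ ℕ^m \ {0} with Σ_{j=1}^{p} a_j x_j = Σ_{j=1}^{m−p} a_{p+j} y_j and ‖a‖ ≤ (m+1) k^{k/2} n^k, such that L(x₀, P) = ⋃_{j=1}^{p} L(C_j, P \ {x_j}), where C_j = { x₀ + λ x_j : λ ∈ {0, 1, …, a_j − 1} } if a_j > 0 and C_j = {x₀} otherwise. -/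
theorem hadamard_sq {ι : Type*} [Fintype ι] [DecidableEq ι] (A : Matrix ι ι ℝ) (N : ℝ)
    (hA : ∀ i j, |A i j| ≤ N) :
    A.det ^ 2 ≤ ((Fintype.card ι : ℝ) * N ^ 2) ^ (Fintype.card ι) := by
  classical
  rcases isEmpty_or_nonempty ι with h | h
  · simp
  have hps : (A.transpose * A).PosSemidef := by
    have := Matrix.posSemidef_conjTranspose_mul_self A
    simpa using this
  have hcard : (0 : ℝ) < Fintype.card ι := by exact_mod_cast Fintype.card_pos
  have hcard' : Fintype.card ι ≠ 0 := Fintype.card_ne_zero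
  have hdet : A.det ^ 2 = ∏ i, hps.isHermitian.eigenvalues i := by
    have := hps.isHermitian.det_eq_prod_eigenvalues
    rw [Matrix.det_mul, Matrix.det_transpose] at this
    rw [sq, this]; simp
  have htr : ∑ i, hps.isHermitian.eigenvalues i = ∑ i, ∑ j, A j i ^ 2 := by
    have := hps.isHermitian.trace_eq_sum_eigenvalues
    simp only [RCLike.ofReal_real_eq_id, id] at this
    rw [← this]
    simp [Matrix.trace, Matrix.mul_apply, sq]
  have htr2 : ∑ i, hps.isHermitian.eigenvalues i
      ≤ (Fintype.card ι : ℝ) * ((Fintype.card ι : ℝ) * N ^ 2) := by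
    rw [htr]
    calc ∑ i, ∑ j, A j i ^ 2 ≤ ∑ i : ι, ∑ j : ι, N ^ 2 :=
          Finset.sum_le_sum fun i _ => Finset.sum_le_sum fun j _ => sq_le_sq' 
            (by linarith [neg_abs_le (A j i), hA j i]) (by linarith [le_abs_self (A j i), hA j i])
      _ = _ := by simp
  have hnn := hps.eigenvalues_nonneg
  have amgm := Real.geom_mean_le_arith_mean Finset.univ (fun _ : ι => (1 : ℝ))
    hps.isHermitian.eigenvalues (by simp) (by simpa using hcard) (fun i _ => hnn i)
  simp only [Real.rpow_one, one_mul, Finset.sum_const, Finset.card_univ, nsmul_eq_mul, mul_one]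
    at amgm
  have hp : 0 ≤ ∏ i, hps.isHermitian.eigenvalues i := Finset.prod_nonneg fun i _ => hnn i
  rw [hdet]
  calc ∏ i, hps.isHermitian.eigenvalues i
      = ((∏ i, hps.isHermitian.eigenvalues i) ^ (Fintype.card ι : ℝ)⁻¹) ^ (Fintype.card ι) :=
        (Real.rpow_inv_natCast_pow hp hcard').symm
    _ ≤ _ := by
        apply pow_le_pow_left₀ (Real.rpow_nonneg hp _)
        refine amgm.trans ?_
        rw [div_le_iff₀ hcard]
        linarith

theorem hadamard_int {ι : Type*} [Fintype ι] [DecidableEq ι] (A : Matrix ι ι ℤ) (N : ℕ)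
    (hA : ∀ i j, |A i j| ≤ N) :
    A.det ^ 2 ≤ ((Fintype.card ι : ℤ) * (N : ℤ) ^ 2) ^ (Fintype.card ι) := by
  have := hadamard_sq (A.map (Int.cast : ℤ → ℝ)) (N : ℝ) (by
    intro i j
    simp only [Matrix.map_apply]
    exact_mod_cast hA i j)
  have h2 : (A.map (Int.cast : ℤ → ℝ)).det = ((A.det : ℤ) : ℝ) := by
    have := (Int.castRingHom ℝ).map_det A
    simpa [RingHom.mapMatrix_apply] using this.symm
  rw [h2] at this
  exact_mod_cast this

/-- A small integer dependency. -/
theorem small_dep {k m n : ℕ} (hk : 1 ≤ k) (hn : 1 ≤ n) (v : Fin m → Fin k → ℕ)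
    (hv : ∀ i j, v i j ≤ n)
    (hdep : ¬ LinearIndependent ℚ (fun i => fun j => (v i j : ℚ))) :
    ∃ c : Fin m → ℤ, c ≠ 0 ∧ (∀ j, ∑ i, c i * (v i j : ℤ) = 0) ∧
      ∀ i, (c i) ^ 2 ≤ ((k : ℤ) * (n : ℤ) ^ 2) ^ k := by
  classical
  set w : Fin m → Fin k → ℚ := fun i => fun j => (v i j : ℚ) with hw
  obtain ⟨κ, a, ha, hspan, hli⟩ := exists_linearIndependent' (K := ℚ) w
  have : Finite κ := Finite.of_injective a ha
  let : Fintype κ := Fintype.ofFinite κ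
  have hi0 : ∃ i0, i0 ∉ Set.range a := by
    by_contra! h
    have hb : Function.Bijective a := ⟨ha, fun x => h x⟩
    apply hdep
    exact (linearIndependent_equiv (Equiv.ofBijective a hb)).1 hli
  obtain ⟨i0, hi0⟩ := hi0
  have hmem : w i0 ∈ Submodule.span ℚ (Set.range (w ∘ a)) := by
    rw [hspan]; exact Submodule.subset_span ⟨i0, rfl⟩
  obtain ⟨t, ht⟩ := (Submodule.mem_span_range_iff_exists_fun ℚ).1 hmem
  have hcardk : Fintype.card κ ≤ k := by
    have := hli.fintype_card_le_finrank
    simpa using this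
  -- choose coordinates
  let M : Matrix κ (Fin k) ℚ := Matrix.of (w ∘ a)
  have hrank : M.rank = Fintype.card κ := LinearIndependent.rank_matrix (M := M) hli
  obtain ⟨κ', b, hb, hspan', hli'⟩ := exists_linearIndependent' (K := ℚ) M.col
  have : Finite κ' := Finite.of_injective b hb
  let : Fintype κ' := Fintype.ofFinite κ'
  have hc' : Fintype.card κ' = Fintype.card κ := by
    rw [← hrank, Matrix.rank_eq_finrank_span_cols, ← hspan']
    exact (finrank_span_eq_card hli').symm
  let e : κ ≃ κ' := (Fintype.equivOfCardEq hc').symm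
  -- integer matrix: rows are coordinates, columns are vectors
  let N : Matrix κ κ ℤ := Matrix.of fun r s => (v (a s) (b (e r)) : ℤ)
  let u : κ → ℤ := fun r => (v i0 (b (e r)) : ℤ)
  have hNd : N.det ≠ 0 := by
    have h1 : IsUnit (N.map (Int.cast : ℤ → ℚ)) := by
      rw [← Matrix.linearIndependent_rows_iff_isUnit]
      have : (N.map (Int.cast : ℤ → ℚ)).row = (M.col ∘ b) ∘ e := by
        ext r s
        simp [N, M, hw, Matrix.row, Matrix.col]
        rfl
      rw [this]
      exact hli'.comp e e.injective
    have h2 := (Matrix.isUnit_iff_isUnit_det _).1 h1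
    have h3 : (N.map (Int.cast : ℤ → ℚ)).det = ((N.det : ℤ) : ℚ) := by
      have := (Int.castRingHom ℚ).map_det N
      simpa [RingHom.mapMatrix_apply] using this.symm
    rw [h3] at h2
    intro h0
    simp [h0] at h2
  have hcr : ∀ s, ((N.cramer u s : ℤ) : ℚ) = N.det * t s := by
    -- N (cramer) = det u and N t = u
    have hinj : Function.Injective ((N.map (Int.cast : ℤ → ℚ)).mulVec) := by
      rw [Matrix.mulVec_injective_iff_isUnit, Matrix.isUnit_iff_isUnit_det]
      have h3 : (N.map (Int.cast : ℤ → ℚ)).det = ((N.det : ℤ) : ℚ) := by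
        have := (Int.castRingHom ℚ).map_det N
        simpa [RingHom.mapMatrix_apply] using this.symm
      rw [h3]
      exact isUnit_iff_ne_zero.2 (by exact_mod_cast hNd)
    have : (fun s => ((N.cramer u s : ℤ) : ℚ)) = fun s => (N.det : ℚ) * t s := by
      apply hinj
      have h1 := Matrix.mulVec_cramer N u
      ext r
      have h1r := congrFun h1 r
      have h2r := congrFun ht (b (e r))
      simp only [Matrix.mulVec, dotProduct, Pi.smul_apply, smul_eq_mul, Matrix.map_apply,
        Finset.sum_apply, Function.comp] at h1r h2r ⊢
      have h1q : (∑ x, (N r x : ℚ) * ((N.cramer u x : ℤ) : ℚ)) = (N.det : ℚ) * (u r : ℚ) := by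
        exact_mod_cast h1r
      rw [h1q]
      have : (u r : ℚ) = w i0 (b (e r)) := by simp [u, hw]
      rw [this, ← h2r, Finset.mul_sum]
      refine Finset.sum_congr rfl fun x _ => ?_
      simp [N, hw]; ring
    exact fun s => congrFun this s
  have hbd : ∀ A : Matrix κ κ ℤ, (∀ i j, |A i j| ≤ (n : ℤ)) →
      A.det ^ 2 ≤ ((k : ℤ) * (n : ℤ) ^ 2) ^ k := by
    intro A hA
    refine (hadamard_int A n hA).trans ?_
    have hk' : (1 : ℤ) ≤ k := by exact_mod_cast hk
    have hn' : (1 : ℤ) ≤ (n : ℤ) ^ 2 := one_le_pow₀ (by exact_mod_cast hn)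
    have hck : (Fintype.card κ : ℤ) ≤ k := by exact_mod_cast hcardk
    calc ((Fintype.card κ : ℤ) * (n : ℤ) ^ 2) ^ (Fintype.card κ)
        ≤ ((k : ℤ) * (n : ℤ) ^ 2) ^ (Fintype.card κ) := by gcongr
      _ ≤ _ := pow_le_pow_right₀ (by nlinarith) hcardk
  have hvabs : ∀ i j, |(v i j : ℤ)| ≤ (n : ℤ) := by
    intro i j
    rw [abs_of_nonneg (by positivity)]
    exact_mod_cast hv i j
  let c : Fin m → ℤ := fun i => if i = i0 then - N.det else
    ∑ s, if a s = i then N.cramer u s else 0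
  have hca : ∀ s, c (a s) = N.cramer u s := by
    intro s
    have : a s ≠ i0 := fun h => hi0 ⟨s, h⟩
    simp only [c, this, if_false]
    rw [Finset.sum_eq_single s]
    · simp
    · intro s' _ hs'
      rw [if_neg (fun h => hs' (ha h))]
    · simp
  have hc0 : c i0 = - N.det := by simp [c]
  have hcn : ∀ i, i ≠ i0 → i ∉ Set.range a → c i = 0 := by
    intro i h1 h2
    simp only [c, h1, if_false]
    refine Finset.sum_eq_zero fun s _ => ?_
    rw [if_neg (fun h => h2 ⟨s, h⟩)]
  refine ⟨c, ?_, ?_, ?_⟩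
  · intro h
    apply hNd
    have := congrFun h i0
    rw [hc0] at this
    simpa using this
  · intro j
    have h1 : ∑ i, c i * (v i j : ℤ) =
        ∑ i ∈ insert i0 (Finset.univ.image a), c i * (v i j : ℤ) := by
      symm
      apply Finset.sum_subset (Finset.subset_univ _)
      intro i _ hi
      rw [hcn i, zero_mul]
      · rintro rfl; simp at hi
      · rintro ⟨s, rfl⟩; simp at hi
    rw [h1, Finset.sum_insert (by simpa using hi0), Finset.sum_image (fun _ _ _ _ h => ha h), hc0]
    simp only [hca]
    have h2 := congrFun ht j
    simp only [Finset.sum_apply, Pi.smul_apply, smul_eq_mul, Function.comp] at h2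
    have h3 : ((-N.det * (v i0 j : ℤ) + ∑ s, N.cramer u s * (v (a s) j : ℤ) : ℤ) : ℚ) = 0 := by
      rw [Int.cast_add, Int.cast_mul, Int.cast_neg, Int.cast_sum]
      simp only [Int.cast_mul, Int.cast_natCast, hcr]
      have h4 : (v i0 j : ℚ) = w i0 j := rfl
      rw [h4, ← h2, Finset.mul_sum, ← Finset.sum_add_distrib]
      refine Finset.sum_eq_zero fun s _ => ?_
      simp only [hw]; ring
    exact_mod_cast h3
  · intro i
    by_cases h1 : i = i0
    · rw [h1, hc0, neg_sq]
      exact hbd N fun r s => hvabs _ _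
    by_cases h2 : i ∈ Set.range a
    · obtain ⟨s, rfl⟩ := h2
      rw [hca, Matrix.cramer_apply]
      apply hbd
      intro r s'
      rw [Matrix.updateCol_apply]
      split_ifs
      · exact hvabs _ _
      · exact hvabs _ _
    · rw [hcn i h1 h2]
      positivity

theorem mem_LSet_image {k m : ℕ} (f : Fin m → Fin k → ℕ) (hf : Function.Injective f)
    (C : Finset (Fin k → ℕ)) (s : Finset (Fin m)) (v : Fin k → ℕ) :
    v ∈ LSet C (s.image f) ↔
      ∃ c ∈ C, ∃ lam : Fin m → ℕ, v = c + ∑ j ∈ s, lam j • f j := by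
  constructor
  · rintro ⟨c, hc, lam, rfl⟩
    refine ⟨c, hc, fun j => lam (f j), ?_⟩
    rw [Finset.sum_image (fun _ _ _ _ h => hf h)]
  · rintro ⟨c, hc, lam, rfl⟩
    refine ⟨c, hc, Function.extend f lam 0, ?_⟩
    rw [Finset.sum_image (fun _ _ _ _ h => hf h)]
    simp [hf.extend_apply]

theorem reduce_coeffs {k m p : ℕ} (f : Fin m → Fin k → ℕ) (a : Fin m → ℕ)
    (j0 : Fin m) (hj0 : (j0 : ℕ) < p) (haj : 0 < a j0)
    (hsum : (∑ j ∈ Finset.univ.filter fun j : Fin m => (j : ℕ) < p, a j • f j) =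
        (∑ j ∈ Finset.univ.filter fun j : Fin m => p ≤ (j : ℕ), a j • f j)) :
    ∀ (N : ℕ) (lam : Fin m → ℕ), lam j0 ≤ N →
      ∃ mu : Fin m → ℕ, ∑ j, mu j • f j = ∑ j, lam j • f j ∧
        ∃ j : Fin m, (j : ℕ) < p ∧ mu j < a j := by
  intro N
  induction N with
  | zero => intro lam h; exact ⟨lam, rfl, j0, hj0, by omega⟩
  | succ N ih =>
    intro lam h
    by_cases hall : ∃ j : Fin m, (j : ℕ) < p ∧ lam j < a j
    · exact ⟨lam, rfl, hall⟩
    push Not at hall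
    obtain ⟨mu, hmu, hj⟩ := ih (fun j => if (j : ℕ) < p then lam j - a j else lam j + a j)
      (by simp only [hj0, if_true]; omega)
    refine ⟨mu, hmu.trans ?_, hj⟩
    apply add_right_cancel
      (b := ∑ j ∈ Finset.univ.filter fun j : Fin m => (j : ℕ) < p, a j • f j)
    conv_rhs => rw [hsum]
    rw [Finset.sum_filter, Finset.sum_filter, ← Finset.sum_add_distrib, ← Finset.sum_add_distrib]
    refine Finset.sum_congr rfl fun j _ => ?_
    by_cases hjp : (j : ℕ) < p
    · have : ¬ p ≤ (j : ℕ) := by omega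
      simp only [hjp, this, if_true, if_false, add_zero]
      rw [← add_smul, Nat.sub_add_cancel (hall j hjp)]
    · have : p ≤ (j : ℕ) := by omega
      simp only [hjp, this, if_true, if_false, add_zero, add_smul]

theorem set_eq {k m p : ℕ} (hp : 1 ≤ p) (P : Finset (Fin k → ℕ)) (x₀ : Fin k → ℕ)
    (f : Fin m → Fin k → ℕ) (a : Fin m → ℕ)
    (hf : Function.Injective f) (hP : Finset.image f Finset.univ = P) (hpm : p ≤ m)
    (ha : ∀ j : Fin m, (j : ℕ) < p → 0 < a j)
    (hsum : (∑ j ∈ Finset.univ.filter fun j : Fin m => (j : ℕ) < p, a j • f j) =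
        (∑ j ∈ Finset.univ.filter fun j : Fin m => p ≤ (j : ℕ), a j • f j)) :
    LSet1 x₀ P = ⋃ j : Fin m, ⋃ _ : (j : ℕ) < p,
        LSet (if a j = 0 then {x₀}
              else (Finset.range (a j)).image fun lam => x₀ + lam • f j)
          (P.erase (f j)) := by
  subst hP
  have her : ∀ j, (Finset.image f Finset.univ).erase (f j) = (Finset.univ.erase j).image f :=
    fun j => (Finset.image_erase hf _ _).symm
  ext v
  simp only [Set.mem_iUnion, her, LSet1, mem_LSet_image f hf, Finset.mem_singleton,
    exists_eq_left, exists_prop]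
  constructor
  · rintro ⟨lam, rfl⟩
    have hp0 : 0 < m := by omega
    obtain ⟨mu, hmu, j, hj, hlt⟩ := reduce_coeffs f a ⟨0, hp0⟩ (show 0 < p from hp)
      (ha _ (show 0 < p from hp)) hsum _ lam le_rfl
    refine ⟨j, hj, x₀ + mu j • f j, ?_, mu, ?_⟩
    · rw [if_neg (by omega)]
      exact Finset.mem_image.2 ⟨mu j, Finset.mem_range.2 hlt, rfl⟩
    · rw [← hmu, ← Finset.add_sum_erase _ _ (Finset.mem_univ j), add_assoc]
  · rintro ⟨j, hj, c, hc, lam, rfl⟩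
    have haj := ha j hj
    rw [if_neg (by omega)] at hc
    obtain ⟨l, _, rfl⟩ := Finset.mem_image.1 hc
    refine ⟨Function.update lam j l, ?_⟩
    rw [← Finset.add_sum_erase _ _ (Finset.mem_univ j), add_assoc]
    simp only [Function.update_self]
    congr 2
    refine Finset.sum_congr rfl fun i hi => ?_
    rw [Function.update_of_ne (Finset.ne_of_mem_erase hi)]

/-- Reorder so that positive coefficients come first. -/
theorem finish {k m : ℕ} (P : Finset (Fin k → ℕ)) (x₀ : Fin k → ℕ) (B : ℝ) (hB : 0 ≤ B)
    (g : Fin m → Fin k → ℕ) (c : Fin m → ℤ)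
    (hg : Function.Injective g) (hP : Finset.image g Finset.univ = P)
    (hc : ∀ i, ((c i).natAbs : ℝ) ≤ B)
    (hsum : ∀ l, ∑ i, c i * (g i l : ℤ) = 0)
    (h1 : 1 ≤ (Finset.univ.filter fun i => 0 < c i).card)
    (h2 : (Finset.univ.filter fun i => 0 < c i).card ≤ m / 2) :
    ∃ (p : ℕ) (f : Fin m → (Fin k → ℕ)) (a : Fin m → ℕ),
      1 ≤ p ∧ p ≤ m / 2 ∧
      Function.Injective f ∧ Finset.image f Finset.univ = P ∧
      a ≠ 0 ∧
      (∑ j ∈ Finset.univ.filter fun j : Fin m => (j : ℕ) < p, a j • f j) =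
        (∑ j ∈ Finset.univ.filter fun j : Fin m => p ≤ (j : ℕ), a j • f j) ∧
      ((Finset.univ.sup a : ℕ) : ℝ) ≤ B ∧
      LSet1 x₀ P = ⋃ j : Fin m, ⋃ _ : (j : ℕ) < p,
        LSet (if a j = 0 then {x₀}
              else (Finset.range (a j)).image fun lam => x₀ + lam • f j)
          (P.erase (f j)) := by
  classical
  set p := (Finset.univ.filter fun i => 0 < c i).card with hp
  have hcp : (Finset.univ.filter fun j : Fin m => (j : ℕ) < p).card = p := by
    rw [Fin.card_filter_val_lt]; omega
  obtain ⟨σ, hσ⟩ := Equiv.Perm.exists_map_finset_eq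
    (Finset.univ.filter fun j : Fin m => (j : ℕ) < p) (Finset.univ.filter fun i => 0 < c i)
    (hcp.trans hp)
  have hiff : ∀ j : Fin m, (j : ℕ) < p ↔ 0 < c (σ j) := by
    intro j
    have : σ j ∈ (Finset.univ.filter fun j : Fin m => (j : ℕ) < p).map σ.toEmbedding ↔
      σ j ∈ (Finset.univ.filter fun i => 0 < c i) := by rw [hσ]
    simpa using this
  have hf : Function.Injective (g ∘ σ) := hg.comp σ.injective
  have him : Finset.image (g ∘ σ) Finset.univ = P := by
    rw [← hP, ← Finset.image_image]; simp
  have hpos : ∀ j : Fin m, (j : ℕ) < p → 0 < (c (σ j)).natAbs := by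
    intro j hj
    have := (hiff j).1 hj
    omega
  have hs : (∑ j ∈ Finset.univ.filter fun j : Fin m => (j : ℕ) < p,
        (c (σ j)).natAbs • (g ∘ σ) j) =
      (∑ j ∈ Finset.univ.filter fun j : Fin m => p ≤ (j : ℕ),
        (c (σ j)).natAbs • (g ∘ σ) j) := by
    ext l
    have h3 := hsum l
    rw [← Equiv.sum_comp σ] at h3
    have : ((∑ j ∈ Finset.univ.filter fun j : Fin m => (j : ℕ) < p,
        (c (σ j)).natAbs * g (σ j) l : ℕ) : ℤ) =
      (∑ j ∈ Finset.univ.filter fun j : Fin m => p ≤ (j : ℕ),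
        (c (σ j)).natAbs * g (σ j) l : ℕ) := by
      rw [← sub_eq_zero, ← h3, Finset.sum_filter, Finset.sum_filter]
      push_cast
      rw [← Finset.sum_sub_distrib]
      refine Finset.sum_congr rfl fun j _ => ?_
      by_cases hj : (j : ℕ) < p
      · have h4 : ¬ p ≤ (j : ℕ) := by omega
        simp only [hj, h4, if_true, if_false]
        rw [abs_of_pos ((hiff j).1 hj)]; simp
      · have h4 : p ≤ (j : ℕ) := by omega
        have h5 : c (σ j) ≤ 0 := by
          have := (hiff j).not.1 hj
          omega
        simp only [hj, h4, if_true, if_false]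
        rw [abs_of_nonpos h5]; simp
    have := Int.ofNat.inj this
    simpa [Finset.sum_apply] using this
  have hm : 0 < m := by omega
  refine ⟨p, g ∘ σ, fun j => (c (σ j)).natAbs, h1, h2, hf, him, ?_, hs, ?_,
    set_eq h1 P x₀ _ _ hf him (by omega) hpos hs⟩
  · intro h
    have h5 := hpos ⟨0, hm⟩ (show 0 < p from h1)
    have := congrFun h ⟨0, hm⟩
    simp only [Pi.zero_apply] at this
    omega
  · have : Nonempty (Fin m) := ⟨⟨0, hm⟩⟩
    obtain ⟨j, _, hj⟩ := Finset.exists_mem_eq_sup (Finset.univ : Finset (Fin m))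
      Finset.univ_nonempty (fun j => (c (σ j)).natAbs)
    rw [hj]
    exact hc _

/-- Rewriting a linear set with a linearly dependent period set: there is an
enumeration `f` of `P`, a split point `p ≤ m/2` and a nonzero vector `a` of
coefficients with `∑_{j<p} a_j f_j = ∑_{j≥p} a_j f_j` and
`‖a‖ ≤ (m+1) k^(k/2) n^k`, such that `L(x₀,P) = ⋃_{j<p} L(C_j, P \ {f_j})`. -/
theorem linear_dep_rewrite (k m n : ℕ) (hk : 2 ≤ k) (hm : 2 ≤ m)
    (P : Finset (Fin k → ℕ)) (hcard : P.card = m)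
    (hdep : ¬ LinIndep P) (hn : snorm P = n) (x₀ : Fin k → ℕ) :
    ∃ (p : ℕ) (f : Fin m → (Fin k → ℕ)) (a : Fin m → ℕ),
      1 ≤ p ∧ p ≤ m / 2 ∧
      Function.Injective f ∧ Finset.image f Finset.univ = P ∧
      a ≠ 0 ∧
      (∑ j ∈ Finset.univ.filter fun j : Fin m => (j : ℕ) < p, a j • f j) =
        (∑ j ∈ Finset.univ.filter fun j : Fin m => p ≤ (j : ℕ), a j • f j) ∧
      ((Finset.univ.sup a : ℕ) : ℝ) ≤ ((m : ℝ) + 1) * (k : ℝ) ^ ((k : ℝ) / 2) * (n : ℝ) ^ k ∧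
      LSet1 x₀ P = ⋃ j : Fin m, ⋃ _ : (j : ℕ) < p,
        LSet (if a j = 0 then {x₀}
              else (Finset.range (a j)).image fun lam => x₀ + lam • f j)
          (P.erase (f j)) := by
  classical
  subst hcard
  let e : Fin P.card ≃ P := P.equivFin.symm
  let g : Fin P.card → Fin k → ℕ := fun i => (e i : Fin k → ℕ)
  have hg : Function.Injective g := Subtype.val_injective.comp e.injective
  have hP : Finset.image g Finset.univ = P := by
    ext x
    simp only [Finset.mem_image, Finset.mem_univ, true_and]
    constructor
    · rintro ⟨i, rfl⟩; exact (e i).2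
    · intro hx; exact ⟨e.symm ⟨x, hx⟩, by simp [g]⟩
  have hle : ∀ x ∈ P, ∀ j, x j ≤ n := by
    intro x hx j
    rw [← hn]
    exact (Finset.le_sup (f := x) (Finset.mem_univ j)).trans (Finset.le_sup (f := vnorm) hx)
  have hn1 : 1 ≤ n := by
    by_contra h
    have h0 : n = 0 := by omega
    have : P ⊆ {0} := by
      intro x hx
      rw [Finset.mem_singleton]
      ext j
      have := hle x hx j
      simp; omega
    have := Finset.card_le_card this
    simp at this; omega
  have hkR : (1 : ℝ) ≤ (k : ℝ) ^ ((k : ℝ) / 2) :=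
    Real.one_le_rpow (by exact_mod_cast (by omega : 1 ≤ k)) (by positivity)
  have hnR : (1 : ℝ) ≤ (n : ℝ) ^ k := one_le_pow₀ (by exact_mod_cast hn1)
  have hX : (1 : ℝ) ≤ (k : ℝ) ^ ((k : ℝ) / 2) * (n : ℝ) ^ k := one_le_mul_of_one_le_of_one_le hkR hnR
  have hXB : (k : ℝ) ^ ((k : ℝ) / 2) * (n : ℝ) ^ k
      ≤ ((P.card : ℝ) + 1) * (k : ℝ) ^ ((k : ℝ) / 2) * (n : ℝ) ^ k := by
    rw [mul_assoc]
    have : (0 : ℝ) ≤ (P.card : ℝ) := by positivity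
    nlinarith
  have hB0 : 0 ≤ ((P.card : ℝ) + 1) * (k : ℝ) ^ ((k : ℝ) / 2) * (n : ℝ) ^ k := by positivity
  by_cases h0 : ∃ i, g i = 0
  · obtain ⟨i, hi⟩ := h0
    have hfil : (Finset.univ.filter fun j => 0 < (Pi.single i 1 : Fin P.card → ℤ) j) = {i} := by
      ext j
      by_cases h : j = i
      · subst h; simp
      · simp [h]
    refine finish P x₀ _ hB0 g (Pi.single i 1) hg hP ?_ ?_ ?_ ?_
    · intro j
      refine le_trans ?_ (hX.trans hXB)
      by_cases h : j = i
      · subst h; simp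
      · simp [h]
    · intro l
      refine Finset.sum_eq_zero fun j _ => ?_
      by_cases h : j = i
      · subst h; simp [hi]
      · simp [h]
    · rw [hfil]; simp
    · rw [hfil]; simp; omega
  push Not at h0
  have hdep' : ¬ LinearIndependent ℚ (fun i => fun j => (g i j : ℚ)) := by
    intro h
    apply hdep
    exact (linearIndependent_equiv e).1 h
  obtain ⟨c, hc0, hcs, hcb⟩ := small_dep (by omega : 1 ≤ k) hn1 g (fun i j => hle _ (e i).2 j) hdep'
  have hcB : ∀ i, ((c i).natAbs : ℝ) ≤
      ((P.card : ℝ) + 1) * (k : ℝ) ^ ((k : ℝ) / 2) * (n : ℝ) ^ k := by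
    intro i
    refine le_trans ?_ hXB
    refine (pow_le_pow_iff_left₀ (by positivity) (by positivity) two_ne_zero).1 ?_
    have h1 : ((c i : ℤ) : ℝ) ^ 2 ≤ ((k : ℝ) * (n : ℝ) ^ 2) ^ k := by exact_mod_cast hcb i
    have h2 : ((c i).natAbs : ℝ) ^ 2 = ((c i : ℤ) : ℝ) ^ 2 := by
      rw [Nat.cast_natAbs, Int.cast_abs, sq_abs]
    have h3 : ((k : ℝ) ^ ((k : ℝ) / 2)) ^ 2 = (k : ℝ) ^ k := by
      rw [← Real.rpow_natCast, ← Real.rpow_mul (by positivity)]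
      norm_num
    rw [h2, mul_pow, h3]
    refine h1.trans (le_of_eq ?_)
    rw [mul_pow, ← pow_mul, ← pow_mul, mul_comm 2 k]
  -- a nontrivial dependency has coefficients of both signs
  have key : ∀ d : Fin P.card → ℤ, d ≠ 0 → (∀ j, ∑ i, d i * (g i j : ℤ) = 0) →
      1 ≤ (Finset.univ.filter fun i => 0 < d i).card := by
    intro d hd hds
    by_contra hcon
    have hcon' : (Finset.univ.filter fun i => 0 < d i) = ∅ := by
      rw [← Finset.card_eq_zero]; omega
    have hneg : ∀ i, d i ≤ 0 := by
      intro i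
      by_contra hi
      have : i ∈ (Finset.univ.filter fun i => 0 < d i) := by
        simp; omega
      rw [hcon'] at this
      simp at this
    apply hd
    ext i
    obtain ⟨j, hj⟩ := Function.ne_iff.1 (h0 i)
    have h1 := (Finset.sum_eq_zero_iff_of_nonpos (fun i _ =>
      mul_nonpos_of_nonpos_of_nonneg (hneg i) (by positivity))).1 (hds j) i (Finset.mem_univ i)
    rcases mul_eq_zero.1 h1 with h | h
    · simpa using h
    · exact absurd (by exact_mod_cast h) hj
  have hnegs : ∀ j, ∑ i, (-c) i * (g i j : ℤ) = 0 := by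
    intro j
    simp only [Pi.neg_apply, neg_mul, Finset.sum_neg_distrib, hcs j, neg_zero]
  have hk1 := key c hc0 hcs
  have hk2 := key (-c) (neg_ne_zero.2 hc0) hnegs
  have htot : (Finset.univ.filter fun i => 0 < c i).card +
      (Finset.univ.filter fun i => 0 < (-c) i).card ≤ P.card := by
    rw [← Finset.card_union_of_disjoint]
    · exact (Finset.card_le_univ _).trans (by simp)
    · rw [Finset.disjoint_filter]
      intro i _ h
      simp only [Pi.neg_apply]; omega
  rcases le_total (Finset.univ.filter fun i => 0 < c i).card
    (Finset.univ.filter fun i => 0 < (-c) i).card with h | h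
  · exact finish P x₀ _ hB0 g c hg hP hcB hcs hk1 (by omega)
  · exact finish P x₀ _ hB0 g (-c) hg hP (by simpa using hcB) hnegs hk2 (by omega)
end

section
/- Let k ≥ 1, let P_i = {x₁, …, x_p} ⊆ ℕ^k and P_j = {y₁, …, y_q} ⊆ ℕ^k be finite sets, and let c_i, c_j ∈ ℕ^k. Let X = { (λ₁,…,λ_p,μ₁,…,μ_q) ∈ ℕ^{p+q} : c_i + Σ_{r=1}^{p} λ_r x_r = c_j + Σ_{s=1}^{q} μ_s y_s }, let C be the set of minimal elements of X, let P be the set of minimal elements of Y \ {0} where Y = { (λ,μ) ∈ ℕ^{p+q} : Σ_{r=1}^{p} λ_r x_r = Σ_{s=1}^{q} μ_s y_s }, and let τ : ℕ^{p+q} → ℕ^k be given by (λ,μ) ↦ Σ_{r=1}^{p} λ_r x_r. Then L(c_i, P_i) ∩ L(c_j, P_j) = L(c_i + τ(C), τ(P)), where c_i + τ(C) = { c_i + v : v ∈ τ(C) }. -/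
theorem mem_LSet_iff_span {k : ℕ} (C P : Finset (Fin k → ℕ)) (v : Fin k → ℕ) :
    v ∈ LSet C P ↔ ∃ c ∈ C, ∃ m ∈ Submodule.span ℕ (P : Set (Fin k → ℕ)), v = c + m := by
  constructor
  · rintro ⟨c, hc, lam, rfl⟩
    exact ⟨c, hc, _, Submodule.sum_mem _ fun a ha =>
      Submodule.smul_mem _ _ (Submodule.subset_span ha), rfl⟩
  · rintro ⟨c, hc, m, hm, rfl⟩
    obtain ⟨f, -, rfl⟩ := Submodule.mem_span_finset.1 hm
    exact ⟨c, hc, f, rfl⟩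

theorem mem_LSet1_image_iff {k p : ℕ} (c : Fin k → ℕ) (x : Fin p → (Fin k → ℕ))
    (v : Fin k → ℕ) :
    v ∈ LSet1 c (Finset.image x Finset.univ) ↔ ∃ l : Fin p → ℕ, v = c + ∑ r, l r • x r := by
  unfold LSet1
  rw [mem_LSet_iff_span]
  simp only [Finset.mem_singleton, exists_eq_left, Finset.coe_image, Finset.coe_univ,
    Set.image_univ, Submodule.mem_span_range_iff_exists_fun]
  constructor
  · rintro ⟨m, ⟨l, rfl⟩, rfl⟩
    exact ⟨l, rfl⟩
  · rintro ⟨l, rfl⟩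
    exact ⟨_, ⟨l, rfl⟩, rfl⟩

/-- Intersection of two linear sets via minimal solutions: with `C` the set of
minimal elements of `X`, `P` the set of minimal elements of `Y \ {0}`, and
`τ(λ,μ) = ∑_r λ_r x_r`, one has
`L(c_i, {x₁,…,x_p}) ∩ L(c_j, {y₁,…,y_q}) = L(c_i + τ(C), τ(P))`. -/
theorem inter_linear_via_minimals (k p q : ℕ) (hk : 1 ≤ k)
    (x : Fin p → (Fin k → ℕ)) (y : Fin q → (Fin k → ℕ))
    (hx : Function.Injective x) (hy : Function.Injective y)
    (ci cj : Fin k → ℕ)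
    (X Y : Set ((Fin p → ℕ) × (Fin q → ℕ)))
    (hX : X = {lm | ci + ∑ r, lm.1 r • x r = cj + ∑ s, lm.2 s • y s})
    (hY : Y = {lm | ∑ r, lm.1 r • x r = ∑ s, lm.2 s • y s})
    (C Pm : Finset ((Fin p → ℕ) × (Fin q → ℕ)))
    (hC : (C : Set ((Fin p → ℕ) × (Fin q → ℕ))) =
      {v | v ∈ X ∧ ∀ w ∈ X, w ≤ v → w = v})
    (hPm : (Pm : Set ((Fin p → ℕ) × (Fin q → ℕ))) =
      {v | v ∈ Y \ {0} ∧ ∀ w ∈ Y \ {0}, w ≤ v → w = v})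
    (τ : ((Fin p → ℕ) × (Fin q → ℕ)) → (Fin k → ℕ))
    (hτ : ∀ lm, τ lm = ∑ r, lm.1 r • x r) :
    LSet1 ci (Finset.image x Finset.univ) ∩ LSet1 cj (Finset.image y Finset.univ) =
      LSet ((C.image τ).image fun v => ci + v) (Pm.image τ) := by
  classical
  let T : ((Fin p → ℕ) × (Fin q → ℕ)) →ₗ[ℕ] (Fin k → ℕ) :=
    (Fintype.linearCombination ℕ x).comp (LinearMap.fst ℕ _ _)
  let U : ((Fin p → ℕ) × (Fin q → ℕ)) →ₗ[ℕ] (Fin k → ℕ) :=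
    (Fintype.linearCombination ℕ y).comp (LinearMap.snd ℕ _ _)
  have hT : ∀ lm, T lm = ∑ r, lm.1 r • x r := fun lm => rfl
  have hU : ∀ lm, U lm = ∑ s, lm.2 s • y s := fun lm => rfl
  have hτT : τ = T := funext fun lm => by rw [hτ, hT]
  have mX : ∀ w, w ∈ X ↔ ci + T w = cj + U w := fun w => by rw [hX]; rfl
  have mY : ∀ w, w ∈ Y ↔ T w = U w := fun w => by rw [hY]; rfl
  have mC : ∀ w, w ∈ C ↔ (w ∈ X ∧ ∀ u ∈ X, u ≤ w → u = w) := fun w => by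
    rw [← Finset.mem_coe, hC]; rfl
  have mP : ∀ w, w ∈ Pm ↔ (w ∈ Y \ {0} ∧ ∀ u ∈ Y \ {0}, u ≤ w → u = w) := fun w => by
    rw [← Finset.mem_coe, hPm]; rfl
  have minex : ∀ (S : Set ((Fin p → ℕ) × (Fin q → ℕ))) (w), w ∈ S →
      ∃ c, (c ∈ S ∧ ∀ u ∈ S, u ≤ c → u = c) ∧ c ≤ w := by
    intro S w hw
    obtain ⟨c, hcw, hc⟩ := exists_minimal_le_of_wellFoundedLT (· ∈ S) w hw
    exact ⟨c, ⟨hc.prop, fun u hu huc => le_antisymm huc (hc.le_of_le hu huc)⟩, hcw⟩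
  have spanY : ∀ w, w ∈ Y → w ∈ Submodule.span ℕ (Pm : Set ((Fin p → ℕ) × (Fin q → ℕ))) := by
    intro w
    induction w using WellFoundedLT.induction with
    | ind w ih =>
    intro hw
    by_cases h0 : w = 0
    · rw [h0]; exact Submodule.zero_mem _
    obtain ⟨c, hc, hcw⟩ := minex (Y \ {0}) w ⟨hw, h0⟩
    obtain ⟨d, rfl⟩ := exists_add_of_le hcw
    have hc0 : c ≠ 0 := hc.1.2
    have hcY := (mY c).1 hc.1.1
    have hd : d ∈ Y := by
      rw [mY] at hw ⊢
      rw [map_add, map_add, hcY] at hw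
      exact add_left_cancel hw
    have hlt : d < c + d := by
      refine lt_of_le_of_ne le_add_self fun h => hc0 ?_
      exact add_eq_right.1 h.symm
    exact Submodule.add_mem _ (Submodule.subset_span ((mP c).2 hc)) (ih d hlt hd)
  have spanY' : ∀ w, w ∈ Submodule.span ℕ (Pm : Set ((Fin p → ℕ) × (Fin q → ℕ))) → T w = U w := by
    intro w hw
    have : Submodule.span ℕ (Pm : Set ((Fin p → ℕ) × (Fin q → ℕ))) ≤ LinearMap.eqLocus T U :=
      Submodule.span_le.2 fun a ha => (mY a).1 ((mP a).1 ha).1.1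
    exact this hw
  ext v
  rw [Set.mem_inter_iff, mem_LSet1_image_iff, mem_LSet1_image_iff, mem_LSet_iff_span, hτT,
    Finset.coe_image, Submodule.span_image]
  constructor
  · rintro ⟨⟨l, hl⟩, ⟨m, hm⟩⟩
    have hw : (l, m) ∈ X := by
      rw [mX, hT, hU]
      exact hl.symm.trans hm
    obtain ⟨c, hc, hcw⟩ := minex X (l, m) hw
    obtain ⟨d, hd⟩ := exists_add_of_le hcw
    have hdY : d ∈ Y := by
      rw [mX, hd, map_add, map_add, ← add_assoc, ← add_assoc, (mX c).1 hc.1] at hw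
      exact (mY d).2 (add_left_cancel hw)
    refine ⟨ci + T c, Finset.mem_image_of_mem _ (Finset.mem_image_of_mem _ ((mC c).2 hc)), T d,
      Submodule.mem_map_of_mem (spanY d hdY), ?_⟩
    rw [add_assoc, ← map_add, ← hd, hT]
    exact hl
  · rintro ⟨c', hc', m, hm, rfl⟩
    obtain ⟨t, ht, rfl⟩ := Finset.mem_image.1 hc'
    obtain ⟨c, hc, rfl⟩ := Finset.mem_image.1 ht
    obtain ⟨d, hd, rfl⟩ := Submodule.mem_map.1 hm
    refine ⟨⟨(c + d).1, ?_⟩, ⟨(c + d).2, ?_⟩⟩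
    · rw [← hT, map_add, add_assoc]
    · rw [← hU, map_add, ← add_assoc, ← (mX c).1 ((mC c).1 hc).1, spanY' d hd]
end
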